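/- arXiv:1609.03891 — 3 statements merged into one kernel-verified Lean document; each statement's English description precedes it below -/
import Mathlib

section
/- For any permuton process X there exists a sequence of permutation processes σⁿ of S_n (with lengths t_n → ∞) whose trajectory processes Xⁿ converge weakly, as Borel probability measures on C([0,1],[-1,1]), to the law of X. -/
open MeasureTheory Set Filter
open scoped ENNReal Real Topology

/-- The uniform probability measure on [-1,1]. -/
noncomputable def unif : Measure ℝ := (2 : ℝ≥0∞)⁻¹ • (volume.restrict (Icc (-1 : ℝ) 1))

/-- A probability vector on a finite type is approximated, against bounded test functions and with
an error independent of `n`, by the empirical sum of `n` points. -/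
lemma exists_sample_of_weights {ι : Type*} [Fintype ι] [Nonempty ι] (p : ι → ℝ)
    (hp : ∀ c, 0 ≤ p c) (hsum : ∑ c, p c = 1) (n : ℕ) :
    ∃ x : Fin n → ι, ∀ (f : ι → ℝ) (M : ℝ), (∀ c, |f c| ≤ M) →
      |∑ i, f (x i) - n * ∑ c, p c * f c| ≤ 2 * M * Fintype.card ι := by
  classical
  have hfloor : ∀ c, (⌊n * p c⌋₊ : ℝ) ≤ n * p c := fun c =>
    Nat.floor_le (mul_nonneg n.cast_nonneg (hp c))
  have hsum' : ∑ c, (n : ℝ) * p c = n := by rw [← Finset.mul_sum, hsum, mul_one]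
  have hcard : Fintype.card (Σ c, Fin ⌊n * p c⌋₊) ≤ Fintype.card (Fin n) := by
    simp only [Fintype.card_sigma, Fintype.card_fin]
    have : ((∑ c, ⌊n * p c⌋₊ : ℕ) : ℝ) ≤ n := by
      push_cast
      calc _ ≤ ∑ c, (n : ℝ) * p c := Finset.sum_le_sum fun c _ => hfloor c
        _ = n := hsum'
    exact_mod_cast this
  obtain ⟨e⟩ := Function.Embedding.nonempty_of_card_le hcard
  refine ⟨Function.extend e Sigma.fst fun _ => Classical.arbitrary ι, fun f M hf => ?_⟩
  set x : Fin n → ι := Function.extend e Sigma.fst fun _ => Classical.arbitrary ι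
  have hxe : ∀ y, x (e y) = y.1 := fun y => e.injective.extend_apply _ _ y
  have hsplit : ∑ i, f (x i) = ∑ c, (⌊n * p c⌋₊ : ℝ) * f c
      + ∑ i ∈ (Finset.univ.map e)ᶜ, f (x i) := by
    rw [← Finset.sum_add_sum_compl (Finset.univ.map e), Finset.sum_map]
    simp [hxe, Fintype.sum_sigma]
  have hrest : |∑ i ∈ (Finset.univ.map e)ᶜ, f (x i)| ≤ M * (n - ∑ c, (⌊n * p c⌋₊ : ℝ)) := by
    calc _ ≤ ∑ i ∈ (Finset.univ.map e)ᶜ, |f (x i)| := Finset.abs_sum_le_sum_abs _ _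
      _ ≤ ∑ i ∈ (Finset.univ.map e)ᶜ, M := Finset.sum_le_sum fun i _ => hf _
      _ = _ := by
        rw [Finset.sum_const, Finset.card_compl, nsmul_eq_mul, Nat.cast_sub (by simpa using hcard)]
        simp [mul_comm]
  have hgap : ∑ c, ((n : ℝ) * p c - ⌊n * p c⌋₊) ≤ Fintype.card ι := by
    calc _ ≤ ∑ _c : ι, (1 : ℝ) :=
          Finset.sum_le_sum fun c _ => by linarith [Nat.lt_floor_add_one (n * p c)]
      _ = _ := by simp
  have hgap' : (n : ℝ) - ∑ c, (⌊n * p c⌋₊ : ℝ) = ∑ c, ((n : ℝ) * p c - ⌊n * p c⌋₊) := by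
    rw [Finset.sum_sub_distrib, hsum']
  have hmain : |∑ c, (⌊n * p c⌋₊ : ℝ) * f c - n * ∑ c, p c * f c|
      ≤ M * ∑ c, ((n : ℝ) * p c - ⌊n * p c⌋₊) := by
    rw [Finset.mul_sum, ← Finset.sum_sub_distrib, Finset.mul_sum]
    refine (Finset.abs_sum_le_sum_abs _ _).trans (Finset.sum_le_sum fun c _ => ?_)
    have : (⌊n * p c⌋₊ : ℝ) * f c - n * (p c * f c) = -(f c * (n * p c - ⌊n * p c⌋₊)) := by ring
    rw [this, abs_neg, abs_mul, abs_of_nonneg (sub_nonneg.2 (hfloor c))]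
    exact mul_le_mul_of_nonneg_right (hf c) (sub_nonneg.2 (hfloor c))
  have hM : 0 ≤ M := (abs_nonneg _).trans (hf (Classical.arbitrary ι))
  rw [hgap'] at hrest
  have := mul_le_mul_of_nonneg_left hgap hM
  rw [hsplit, add_sub_right_comm]
  exact (abs_add_le _ _).trans (by linarith)

/-- The number of values below `a i` bounds the rank of `i` from below. -/
lemma card_lt_le_sort_symm {n : ℕ} {α : Type*} [LinearOrder α] (a : Fin n → α) (i : Fin n) :
    (Finset.univ.filter fun j => a j < a i).card ≤ ((Tuple.sort a).symm i : ℕ) := by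
  have hmono := Tuple.monotone_sort a
  rw [← Fin.card_Iio, ← Finset.card_map (Tuple.sort a).symm.toEmbedding]
  refine Finset.card_le_card fun r hr => ?_
  obtain ⟨j, hj, rfl⟩ := Finset.mem_map.1 hr
  rw [Finset.mem_Iio]
  by_contra hle
  have := hmono (not_lt.1 hle)
  simp only [Function.comp_apply, Equiv.apply_symm_apply, Equiv.coe_toEmbedding] at this
  exact (Finset.mem_filter.1 hj).2.not_ge this

/-- The number of values at most `a i` bounds the rank of `i` from above. -/
lemma sort_symm_lt_card_le {n : ℕ} {α : Type*} [LinearOrder α] (a : Fin n → α) (i : Fin n) :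
    ((Tuple.sort a).symm i : ℕ) + 1 ≤ (Finset.univ.filter fun j => a j ≤ a i).card := by
  have hmono := Tuple.monotone_sort a
  rw [← Fin.card_Iic, ← Finset.card_map (Tuple.sort a).toEmbedding]
  refine Finset.card_le_card fun j hj => ?_
  obtain ⟨r, hr, rfl⟩ := Finset.mem_map.1 hj
  have := hmono (Finset.mem_Iic.1 hr)
  simpa using this

/-- The function on `[0,1]` interpolating linearly between the values `u k` at the points `k / m`,
for `k ≤ m`. -/
noncomputable def linearInterp (m : ℕ) (u : ℕ → ℝ) : C(Icc (0:ℝ) 1, ℝ) where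
  toFun s := u 0 + ∑ k ∈ Finset.range m, (u (k + 1) - u k) * max 0 (min 1 (m * (s : ℝ) - k))
  continuous_toFun := by fun_prop

lemma linearInterp_apply {m : ℕ} (u : ℕ → ℝ) {k : ℕ} (hk : k < m) (s : Icc (0:ℝ) 1)
    (h₁ : (k : ℝ) / m ≤ s) (h₂ : (s : ℝ) ≤ ((k : ℝ) + 1) / m) :
    linearInterp m u s
      = m * ((((k : ℝ) + 1) / m - s) * u k + ((s : ℝ) - (k : ℝ) / m) * u (k + 1)) := by
  have hm : (0 : ℝ) < m := by exact_mod_cast (Nat.zero_le k).trans_lt hk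
  rw [div_le_iff₀ hm] at h₁
  rw [le_div_iff₀ hm] at h₂
  obtain ⟨l, rfl⟩ := Nat.exists_eq_add_of_lt hk
  have hlow : ∑ j ∈ Finset.range k,
      (u (j + 1) - u j) * max 0 (min 1 (((k + l + 1 : ℕ) : ℝ) * (s : ℝ) - j)) = u k - u 0 := by
    rw [← Finset.sum_range_sub]
    refine Finset.sum_congr rfl fun j hj => ?_
    have hj' : (j : ℝ) + 1 ≤ k := by exact_mod_cast Finset.mem_range.1 hj
    rw [min_eq_left (by linarith), max_eq_right zero_le_one, mul_one]
  have hhigh : ∑ j ∈ Finset.range l, (u (k + 1 + j + 1) - u (k + 1 + j)) *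
      max 0 (min 1 (((k + l + 1 : ℕ) : ℝ) * (s : ℝ) - (k + 1 + j : ℕ))) = 0 := by
    refine Finset.sum_eq_zero fun j _ => ?_
    have hj : (0 : ℝ) ≤ j := j.cast_nonneg
    rw [max_eq_left ((min_le_right _ _).trans _), mul_zero]
    push_cast at h₂ ⊢
    linarith
  change u 0 + ∑ j ∈ Finset.range (k + l + 1), _ = _
  rw [add_right_comm k l 1, Finset.sum_range_add, Finset.sum_range_succ, add_right_comm k 1 l,
    hlow, hhigh, max_eq_right (le_min zero_le_one (by linarith)), min_eq_right (by linarith)]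
  field_simp
  ring

lemma exists_mem_grid_cell {m : ℕ} (hm : 0 < m) (s : Icc (0:ℝ) 1) :
    ∃ k < m, (k : ℝ) / m ≤ s ∧ (s : ℝ) ≤ ((k : ℝ) + 1) / m := by
  have hm' : (0 : ℝ) < m := by exact_mod_cast hm
  have hs := s.2.1
  rcases s.2.2.lt_or_eq with h | h
  · refine ⟨⌊m * (s : ℝ)⌋₊, ?_, ?_, ?_⟩
    · rw [Nat.floor_lt (by positivity)]
      nlinarith
    · rw [div_le_iff₀ hm', mul_comm]
      exact Nat.floor_le (by positivity)
    · rw [le_div_iff₀ hm', mul_comm]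
      exact (Nat.lt_floor_add_one _).le
  · refine ⟨m - 1, by omega, ?_, ?_⟩ <;> rw [h, Nat.cast_sub hm, Nat.cast_one]
    · rw [div_le_one hm']; linarith
    · rw [sub_add_cancel, div_self hm'.ne']

/-- An estimate valid at both ends of every grid cell passes to the interpolation. -/
lemma abs_linearInterp_sub_le {m : ℕ} (hm : 0 < m) (u : ℕ → ℝ) (s : Icc (0:ℝ) 1) (y ε : ℝ)
    (h : ∀ k < m, (k : ℝ) / m ≤ s → (s : ℝ) ≤ ((k : ℝ) + 1) / m →
      |u k - y| ≤ ε ∧ |u (k + 1) - y| ≤ ε) :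
    |linearInterp m u s - y| ≤ ε := by
  have hm' : (0 : ℝ) < m := by exact_mod_cast hm
  obtain ⟨k, hk, h₁, h₂⟩ := exists_mem_grid_cell hm s
  obtain ⟨ha, hb⟩ := h k hk h₁ h₂
  rw [linearInterp_apply u hk s h₁ h₂]
  rw [div_le_iff₀ hm'] at h₁
  rw [le_div_iff₀ hm'] at h₂
  have : (m : ℝ) * ((((k : ℝ) + 1) / m - s) * u k + ((s : ℝ) - (k : ℝ) / m) * u (k + 1)) - y
      = (k + 1 - s * m) * (u k - y) + (s * m - k) * (u (k + 1) - y) := by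
    field_simp
    ring
  rw [this]
  rw [abs_le] at ha hb ⊢
  constructor <;> nlinarith

lemma linearInterp_sub (m : ℕ) (u v : ℕ → ℝ) :
    linearInterp m u - linearInterp m v = linearInterp m (u - v) := by
  ext s
  simp only [linearInterp, ContinuousMap.sub_apply, ContinuousMap.coe_mk, Pi.sub_apply]
  rw [add_sub_add_comm, ← Finset.sum_sub_distrib]
  congr 1
  exact Finset.sum_congr rfl fun k _ => by ring

lemma dist_linearInterp_le {m : ℕ} (hm : 0 < m) (u v : ℕ → ℝ) {ε : ℝ}
    (h : ∀ k, |u k - v k| ≤ ε) : dist (linearInterp m u) (linearInterp m v) ≤ ε := by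
  rw [dist_eq_norm, linearInterp_sub, ContinuousMap.norm_le _ ((abs_nonneg _).trans (h 0))]
  intro s
  have := abs_linearInterp_sub_le hm (u - v) s 0 ε fun k _ _ _ => by simp [h]
  simpa using this

/-- Index of the cell of `[-1,1]`, cut into `N` equal cells, that contains `x`. -/
noncomputable def cell (N : ℕ) (x : ℝ) : Fin (N + 1) :=
  ⟨min N ⌊(x + 1) / 2 * N⌋₊, Nat.lt_succ_of_le (min_le_left _ _)⟩

/-- Left end of a cell of `[-1,1]`. -/
noncomputable def cellLeft {N : ℕ} (j : Fin (N + 1)) : ℝ := 2 * (j : ℕ) / N - 1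

lemma measurable_cell (N : ℕ) : Measurable (cell N) := by
  have h : Measurable fun x : ℝ => ⌊(x + 1) / 2 * N⌋₊ := Nat.measurable_floor.comp (by fun_prop)
  exact (measurable_of_countable fun k : ℕ =>
    (⟨min N k, Nat.lt_succ_of_le (min_le_left _ _)⟩ : Fin (N + 1))).comp h

lemma abs_cellLeft_cell_sub_le {N : ℕ} (hN : 0 < N) {x : ℝ} (hx : x ∈ Icc (-1 : ℝ) 1) :
    |cellLeft (cell N x) - x| ≤ 2 / N := by
  have hN' : (0 : ℝ) < N := by exact_mod_cast hN
  have hle : ⌊(x + 1) / 2 * N⌋₊ ≤ N := by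
    refine Nat.floor_le_of_le ?_
    nlinarith [hx.2]
  have h₁ := Nat.floor_le (show 0 ≤ (x + 1) / 2 * N by nlinarith [hx.1])
  have h₂ := (Nat.lt_floor_add_one ((x + 1) / 2 * N)).le
  simp only [cellLeft, cell, min_eq_right hle]
  have : 2 * (⌊(x + 1) / 2 * N⌋₊ : ℝ) / N - 1 - x
      = 2 * (⌊(x + 1) / 2 * N⌋₊ - (x + 1) / 2 * N) / N := by
    field_simp
    ring
  rw [this, abs_div, abs_of_pos hN']
  gcongr
  rw [abs_le]
  constructor <;> linarith

lemma unif_real_cell_lt {N j : ℕ} (hN : 0 < N) (hj : j ≤ N) :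
    unif.real {x | (cell N x : ℕ) < j} = j / N := by
  have hN' : (0 : ℝ) < N := by exact_mod_cast hN
  have hj' : (j : ℝ) / N ≤ 1 := by
    rw [div_le_one hN']; exact_mod_cast hj
  have hmeas : MeasurableSet {x | (cell N x : ℕ) < j} :=
    measurable_cell N (Set.toFinite {c : Fin (N + 1) | (c : ℕ) < j}).measurableSet
  have hset : {x | (cell N x : ℕ) < j} ∩ Icc (-1 : ℝ) 1 = Ico (-1 : ℝ) (2 * (j / N) - 1) := by
    ext x
    have key : -1 ≤ x → ((cell N x : ℕ) < j ↔ x < 2 * (j / N) - 1) := fun h => by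
      have : x < 2 * (j / N) - 1 ↔ (x + 1) / 2 * N < j := by
        rw [← lt_div_iff₀ hN']
        constructor <;> intro h <;> linarith
      rw [this, ← Nat.floor_lt (by nlinarith)]
      simp only [cell, min_lt_iff]
      omega
    simp only [mem_inter_iff, mem_ofPred_eq, mem_Icc, mem_Ico]
    constructor
    · rintro ⟨h₁, h₂, -⟩
      exact ⟨h₂, (key h₂).1 h₁⟩
    · rintro ⟨h₁, h₂⟩
      exact ⟨(key h₁).2 h₂, h₁, by linarith⟩
  rw [measureReal_def, unif, Measure.smul_apply, Measure.restrict_apply hmeas, hset,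
    Real.volume_Ico, smul_eq_mul, ENNReal.toReal_mul, ENNReal.toReal_ofReal (by
      have : (0 : ℝ) ≤ j / N := by positivity
      linarith)]
  simp

lemma exists_slow_sequence (h : ℕ → ℕ) :
    ∃ m : ℕ → ℕ, Tendsto m atTop atTop ∧ ∀ᶠ n in atTop, h (m n) ≤ n := by
  refine ⟨fun n => Nat.findGreatest (fun k => h k ≤ n) n, ?_, ?_⟩
  · refine tendsto_atTop.2 fun K => ?_
    filter_upwards [eventually_ge_atTop K, eventually_ge_atTop (h K)] with n h₁ h₂
    exact Nat.le_findGreatest h₁ h₂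
  · filter_upwards [eventually_ge_atTop (h 0)] with n hn
    exact Nat.findGreatest_spec (P := fun k => h k ≤ n) (Nat.zero_le n) hn

/-- The cells visited by the path `ω` at the times `k / N`. -/
noncomputable def cellPath {Ω : Type*} (X : ℝ → Ω → ℝ) (N : ℕ) (ω : Ω) :
    Fin (N + 1) → Fin (N + 1) :=
  fun k => cell N (X ((k : ℕ) / N) ω)

/-- The piecewise linear path through the left ends of the given cells. -/
noncomputable def interpCells {N : ℕ} (c : Fin (N + 1) → Fin (N + 1)) : C(Icc (0:ℝ) 1, ℝ) :=
  linearInterp N fun k => cellLeft (c (Fin.ofNat (N + 1) k))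

lemma grid_mem_Icc {k N : ℕ} (hk : k ≤ N) : (k : ℝ) / N ∈ Icc (0:ℝ) 1 :=
  ⟨by positivity, div_le_one_of_le₀ (by exact_mod_cast hk) (by positivity)⟩

section

variable {Ω : Type*} [MeasurableSpace Ω] {P : Measure Ω} {X : ℝ → Ω → ℝ}

lemma unif_univ : unif univ = 1 := by
  simp only [unif, Measure.smul_apply, Measure.restrict_apply_univ, Real.volume_Icc, smul_eq_mul]
  norm_num
  exact ENNReal.inv_mul_cancel (by simp) (by simp)

lemma aemeasurable_of_map_eq_unif {Y : Ω → ℝ} (hY : P.map Y = unif) : AEMeasurable Y P := by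
  refine AEMeasurable.of_map_ne_zero fun h => ?_
  have := unif_univ
  rw [← hY, h] at this
  simp at this

lemma aemeasurable_cellPath (hX : ∀ t ∈ Icc (0:ℝ) 1, P.map (X t) = unif) (N : ℕ) :
    AEMeasurable (cellPath X N) P :=
  aemeasurable_pi_iff.2 fun k => (measurable_cell N).comp_aemeasurable
    (aemeasurable_of_map_eq_unif (hX _ (grid_mem_Icc (Nat.le_of_lt_succ k.2))))

lemma measureReal_cellPath_lt (hX : ∀ t ∈ Icc (0:ℝ) 1, P.map (X t) = unif) {N j : ℕ} (hN : 0 < N)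
    (hj : j ≤ N) (k : Fin (N + 1)) : P.real {ω | (cellPath X N ω k : ℕ) < j} = j / N := by
  have hk := hX _ (grid_mem_Icc (Nat.le_of_lt_succ k.2))
  have hmeas : MeasurableSet {x | (cell N x : ℕ) < j} :=
    measurable_cell N (Set.toFinite {c : Fin (N + 1) | (c : ℕ) < j}).measurableSet
  rw [← unif_real_cell_lt hN hj, ← hk, measureReal_def, measureReal_def,
    Measure.map_apply_of_aemeasurable (aemeasurable_of_map_eq_unif hk) hmeas]
  rfl

/-- A sample of `n` cell sequences is good if its empirical sums are within an error independent
of `n` of the expectations under the law of the discretized process. -/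
def IsGoodSample (P : Measure Ω) (X : ℝ → Ω → ℝ) {N n : ℕ}
    (x : Fin n → Fin (N + 1) → Fin (N + 1)) : Prop :=
  ∀ (f : (Fin (N + 1) → Fin (N + 1)) → ℝ) (M : ℝ), (∀ c, |f c| ≤ M) →
    |∑ i, f (x i) - n * ∫ ω, f (cellPath X N ω) ∂P| ≤ 2 * M * ((N + 1) ^ (N + 1) : ℕ)

lemma exists_isGoodSample [IsProbabilityMeasure P]
    (hX : ∀ t ∈ Icc (0:ℝ) 1, P.map (X t) = unif) (N n : ℕ) :
    ∃ x : Fin n → Fin (N + 1) → Fin (N + 1), IsGoodSample P X x := by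
  have hg := aemeasurable_cellPath hX N
  have := Measure.isProbabilityMeasure_map hg
  obtain ⟨x, hx⟩ := exists_sample_of_weights (fun c => (P.map (cellPath X N)).real {c})
    (fun c => measureReal_nonneg) (by simp) n
  refine ⟨x, fun f M hf => ?_⟩
  have hint : ∫ ω, f (cellPath X N ω) ∂P
      = ∑ c, (P.map (cellPath X N)).real {c} * f c := by
    rw [← integral_map hg (measurable_of_countable f).aestronglyMeasurable,
      integral_fintype (.of_finite)]
    rfl
  have := hx f M hf
  rw [hint]
  simpa using this

lemma IsGoodSample.abs_card_lt_sub_le (hX : ∀ t ∈ Icc (0:ℝ) 1, P.map (X t) = unif) {N n : ℕ}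
    (hN : 0 < N) {x : Fin n → Fin (N + 1) → Fin (N + 1)} (hx : IsGoodSample P X x)
    (k : Fin (N + 1)) {j : ℕ} (hj : j ≤ N) :
    |((Finset.univ.filter fun i => (x i k : ℕ) < j).card : ℝ) - n * (j / N)|
      ≤ 2 * ((N + 1) ^ (N + 1) : ℕ) := by
  have := hx (fun c => if (c k : ℕ) < j then 1 else 0) 1 fun c => by split_ifs <;> simp
  rw [Finset.sum_boole, mul_one] at this
  convert this using 4
  rw [← measureReal_cellPath_lt hX hN hj k]
  have hmeas : NullMeasurableSet {ω | (cellPath X N ω k : ℕ) < j} P :=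
    (aemeasurable_cellPath hX N).nullMeasurableSet_preimage
      (Set.toFinite {c : Fin (N + 1) → Fin (N + 1) | (c k : ℕ) < j}).measurableSet
  have hind : (fun ω => if (cellPath X N ω k : ℕ) < j then (1 : ℝ) else 0)
      = {ω | (cellPath X N ω k : ℕ) < j}.indicator fun _ => 1 := by
    ext ω
    simp [indicator_apply]
  rw [hind, integral_indicator₀ hmeas]
  simp

/-- In a good sample the rescaled rank at each time is close to the position of the cell. -/
lemma IsGoodSample.abs_rank_sub_cellLeft_le (hX : ∀ t ∈ Icc (0:ℝ) 1, P.map (X t) = unif)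
    {N n : ℕ} (hN : 0 < N) {x : Fin n → Fin (N + 1) → Fin (N + 1)} (hx : IsGoodSample P X x)
    (k : Fin (N + 1)) (i : Fin n) :
    |2 * ((((Tuple.sort fun j => x j k).symm i : ℕ) : ℝ) + 1) / n - 1 - cellLeft (x i k)|
      ≤ 2 / N + 6 * ((N + 1) ^ (N + 1) : ℕ) / n := by
  have hN' : (0 : ℝ) < N := by exact_mod_cast hN
  have hn : (0 : ℝ) < n := by exact_mod_cast i.pos
  set r := ((Tuple.sort fun j => x j k).symm i : ℕ)
  set C := (((N + 1) ^ (N + 1) : ℕ) : ℝ)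
  have hC0 : 0 ≤ C := Nat.cast_nonneg _
  set a : ℕ := (x i k).val
  have haN : a ≤ N := Nat.le_of_lt_succ (x i k).2
  have hlow : n * ((a : ℝ) / N) - 2 * C ≤ r + 1 := by
    have h₁ := abs_le.1 (hx.abs_card_lt_sub_le hX hN k haN)
    have h₂ : ((Finset.univ.filter fun j => (x j k : ℕ) < a).card : ℝ) ≤ r := by
      exact_mod_cast card_lt_le_sort_symm (fun j => x j k) i
    linarith [h₁.1]
  have hup : (r : ℝ) + 1 ≤ n * (((a : ℝ) + 1) / N) + 2 * C := by
    rcases haN.lt_or_eq with h | h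
    · have h₁ := abs_le.1 (hx.abs_card_lt_sub_le hX hN k (Nat.succ_le_of_lt h))
      have h₂ : (r : ℝ) + 1
          ≤ (Finset.univ.filter fun j => (x j k : ℕ) < a.succ).card := by
        simp only [Nat.lt_succ_iff]
        exact_mod_cast sort_symm_lt_card_le (fun j => x j k) i
      rw [Nat.cast_succ] at h₁
      linarith [h₁.2]
    · have h₁ : (r : ℝ) + 1 ≤ n := by
        exact_mod_cast ((Tuple.sort fun j => x j k).symm i).2
      have h₂ : (1 : ℝ) ≤ ((a : ℝ) + 1) / N := by
        rw [one_le_div hN', h]; linarith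
      nlinarith
  have hrw : 2 * ((r : ℝ) + 1) / n - 1 - cellLeft (x i k)
      = 2 * (r + 1 - n * ((a : ℝ) / N)) / n := by
    rw [cellLeft]
    field_simp
    ring
  have hrw' : 2 / (N : ℝ) + 6 * C / n = 2 * (n * (1 / N) + 3 * C) / n := by
    field_simp
    ring
  rw [hrw, hrw', abs_div, abs_of_pos hn]
  have h₃ : n * (((a : ℝ) + 1) / N) = n * ((a : ℝ) / N) + n * (1 / N) := by ring
  have h₄ : 0 ≤ n * (1 / (N : ℝ)) := by positivity
  gcongr
  rw [abs_le]
  constructor <;> linarith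

end

/-- The discretized path converges uniformly to the path as the grid is refined. -/
lemma tendsto_interpCells_cellPath {Ω : Type*} (X : ℝ → Ω → ℝ) (ω : Ω)
    (hcont : Continuous fun s : Icc (0:ℝ) 1 => X (s : ℝ) ω)
    (hval : ∀ t ∈ Icc (0:ℝ) 1, X t ω ∈ Icc (-1 : ℝ) 1) :
    Tendsto (fun N => interpCells (cellPath X N ω)) atTop
      (𝓝 ⟨fun s : Icc (0:ℝ) 1 => X (s : ℝ) ω, hcont⟩) := by
  rw [Metric.tendsto_nhds]
  intro ε hε
  obtain ⟨δ, hδ, hunif⟩ := Metric.uniformContinuous_iff.1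
    (CompactSpace.uniformContinuous_of_continuous hcont) (ε / 4) (by positivity)
  have h₁ : ∀ᶠ N : ℕ in atTop, 2 / (N : ℝ) < ε / 4 :=
    (tendsto_const_div_atTop_nhds_zero_nat 2).eventually_lt_const (by positivity)
  have h₂ : ∀ᶠ N : ℕ in atTop, 1 / (N : ℝ) < δ :=
    (tendsto_const_div_atTop_nhds_zero_nat 1).eventually_lt_const hδ
  filter_upwards [h₁, h₂, eventually_gt_atTop 0] with N hN₁ hN₂ hN
  refine lt_of_le_of_lt (b := ε / 2) ?_ (by linarith)
  rw [ContinuousMap.dist_le (by positivity)]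
  intro s
  rw [Real.dist_eq]
  refine abs_linearInterp_sub_le hN _ s _ _ fun k hk hs₁ hs₂ => ?_
  have key : ∀ l ≤ N, |(l : ℝ) / N - s| < δ →
      |cellLeft (cellPath X N ω (Fin.ofNat (N + 1) l)) - X s ω| ≤ ε / 2 := fun l hl hdist => by
    have hval' : ((Fin.ofNat (N + 1) l : Fin (N + 1)) : ℕ) = l :=
      Nat.mod_eq_of_lt (Nat.lt_succ_of_le hl)
    have ha := abs_cellLeft_cell_sub_le hN (hval _ (grid_mem_Icc hl))
    have hb : |X ((l : ℝ) / N) ω - X s ω| < ε / 4 :=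
      hunif (a := ⟨(l : ℝ) / N, grid_mem_Icc hl⟩) (b := s) hdist
    rw [cellPath, hval']
    exact (abs_sub_le _ (X ((l : ℝ) / N) ω) _).trans (by linarith)
  have hstep : ((k : ℝ) + 1) / N = k / N + 1 / N := by ring
  refine ⟨key k hk.le ?_, key (k + 1) hk ?_⟩
  · rw [abs_lt]; constructor <;> linarith
  · rw [Nat.cast_succ, abs_lt]; constructor <;> linarith

/-- every permuton process is the weak limit of the trajectory processes of
a sequence of permutation processes with lengths tₙ → ∞. -/
theorem permuton_process_is_limit_of_permutation_processes
    {Ω : Type*} [MeasurableSpace Ω] (P : Measure Ω) [IsProbabilityMeasure P]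
    (X : ℝ → Ω → ℝ)
    (hXcont : ∀ ω, Continuous fun s : Icc (0:ℝ) 1 => X (s : ℝ) ω)
    (hXval : ∀ t ∈ Icc (0:ℝ) 1, ∀ ω, X t ω ∈ Icc (-1 : ℝ) 1)
    (hXunif : ∀ t ∈ Icc (0:ℝ) 1, P.map (X t) = unif) :
    ∃ (tn : ℕ → ℕ) (σ : (n : ℕ) → ℕ → Equiv.Perm (Fin n))
      (T : (n : ℕ) → Fin n → C(Icc (0:ℝ) 1, ℝ)),
      Tendsto tn atTop atTop ∧
      (∀ n, σ n 0 = 1) ∧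
      (∀ n : ℕ, ∀ i : Fin n, ∀ k : ℕ, k < tn n → ∀ s : Icc (0:ℝ) 1,
      (k : ℝ) / tn n ≤ (s : ℝ) → (s : ℝ) ≤ ((k : ℝ) + 1) / tn n →
      T n i s = (tn n : ℝ) *
        ((((k : ℝ) + 1) / tn n - (s : ℝ)) * (2 * (((σ n k i : ℕ) : ℝ) + 1) / n - 1) +
          ((s : ℝ) - (k : ℝ) / tn n) * (2 * (((σ n (k + 1) i : ℕ) : ℝ) + 1) / n - 1))) ∧
      (∀ F : C(Icc (0:ℝ) 1, ℝ) → ℝ, UniformContinuous F → (∃ M : ℝ, ∀ f, |F f| ≤ M) →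
      Tendsto (fun n : ℕ => (1 / (n : ℝ)) * ∑ i : Fin n, F (T n i)) atTop
        (𝓝 (∫ ω, F ⟨fun s : Icc (0:ℝ) 1 => X (s : ℝ) ω, hXcont ω⟩ ∂P))) := by
  obtain ⟨m, hm, hslow⟩ := exists_slow_sequence fun k => (k + 1) * (k + 2) ^ (k + 2)
  choose x hx using fun n => exists_isGoodSample hXunif (m n + 1) n
  let rank : (n : ℕ) → ℕ → Equiv.Perm (Fin n) := fun n k =>
    (Tuple.sort fun j => x n j (Fin.ofNat (m n + 1 + 1) k)).symm
  let pos : (n : ℕ) → Fin n → ℕ → ℝ := fun n i k => 2 * (((rank n k i : ℕ) : ℝ) + 1) / n - 1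
  have hN : Tendsto (fun n => m n + 1) atTop atTop := (tendsto_add_atTop_nat 1).comp hm
  refine ⟨fun n => m n + 1, fun n k => (rank n 0).symm.trans (rank n k),
    fun n i => linearInterp (m n + 1) (pos n ((rank n 0).symm i)), hN,
    fun n => (rank n 0).symm_trans_self,
    fun n i k hk s h₁ h₂ => linearInterp_apply _ hk s h₁ h₂, ?_⟩
  rintro F hF ⟨M, hM⟩
  have hratio : ∀ᶠ n : ℕ in atTop,
      (((m n + 1 + 1) ^ (m n + 1 + 1) : ℕ) : ℝ) / n ≤ 1 / (m n + 1 : ℕ) := by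
    filter_upwards [hslow, eventually_gt_atTop 0] with n hn hn0
    rw [div_le_div_iff₀ (by exact_mod_cast hn0) (by positivity), one_mul, mul_comm]
    exact_mod_cast hn
  have hinv : ∀ a : ℝ, Tendsto (fun n => a / (m n + 1 : ℕ)) atTop (𝓝 0) := fun a =>
    (tendsto_const_div_atTop_nhds_zero_nat a).comp hN
  have hdiscrete : Tendsto (fun n => ∫ ω, F (interpCells (cellPath X (m n + 1) ω)) ∂P) atTop
      (𝓝 (∫ ω, F ⟨fun s : Icc (0:ℝ) 1 => X (s : ℝ) ω, hXcont ω⟩ ∂P)) := by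
    refine tendsto_integral_of_dominated_convergence (fun _ => M) (fun n => ?_)
      (integrable_const M) (fun n => ae_of_all _ fun ω => hM _) (ae_of_all _ fun ω => ?_)
    · exact ((measurable_of_countable fun c : Fin (m n + 1 + 1) → Fin (m n + 1 + 1) =>
        F (interpCells c)).comp_aemeasurable
          (aemeasurable_cellPath hXunif (m n + 1))).aestronglyMeasurable
    · exact (hF.continuous.tendsto _).comp ((tendsto_interpCells_cellPath X ω (hXcont ω)
        fun t ht => hXval t ht ω).comp hN)
  have hsample : Tendsto (fun n : ℕ => (1 / (n : ℝ)) * ∑ i, F (interpCells (x n i))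
      - ∫ ω, F (interpCells (cellPath X (m n + 1) ω)) ∂P) atTop (𝓝 0) := by
    refine squeeze_zero_norm' ?_ (hinv (2 * M))
    filter_upwards [hratio, eventually_gt_atTop 0] with n hn hn0
    have hn0' : (0 : ℝ) < n := by exact_mod_cast hn0
    have hM0 : 0 ≤ M := (abs_nonneg _).trans (hM 0)
    have h := hx n (fun c => F (interpCells c)) M fun c => hM _
    rw [Real.norm_eq_abs]
    calc _ = |∑ i, F (interpCells (x n i))
          - n * ∫ ω, F (interpCells (cellPath X (m n + 1) ω)) ∂P| / n := by
          rw [← abs_of_pos hn0', ← abs_div, abs_of_pos hn0']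
          congr 1
          field_simp
      _ ≤ 2 * M * ((m n + 1 + 1) ^ (m n + 1 + 1) : ℕ) / n := by gcongr
      _ = 2 * M * (((m n + 1 + 1) ^ (m n + 1 + 1) : ℕ) / n) := by ring
      _ ≤ 2 * M * (1 / (m n + 1 : ℕ)) := by gcongr
      _ = _ := by ring
  have hrank : Tendsto (fun n : ℕ =>
      (1 / (n : ℝ)) * ∑ i, F (linearInterp (m n + 1) (pos n ((rank n 0).symm i)))
      - (1 / (n : ℝ)) * ∑ i, F (interpCells (x n i))) atTop (𝓝 0) := by
    rw [Metric.tendsto_nhds]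
    intro ε hε
    obtain ⟨δ, hδ, hFδ⟩ := Metric.uniformContinuous_iff.1 hF (ε / 2) (by positivity)
    filter_upwards [hratio, eventually_gt_atTop 0, (hinv 8).eventually_lt_const hδ]
      with n hn hn0 hnδ
    have hn0' : (0 : ℝ) < n := by exact_mod_cast hn0
    have hclose : ∀ i, |F (linearInterp (m n + 1) (pos n i)) - F (interpCells (x n i))| ≤ ε / 2 :=
      fun i => by
      refine (hFδ (lt_of_le_of_lt (dist_linearInterp_le (Nat.succ_pos _) _ _ fun k => ?_) hnδ)).le
      refine ((hx n).abs_rank_sub_cellLeft_le hXunif (Nat.succ_pos _) _ i).trans ?_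
      rw [mul_div_assoc]
      calc _ ≤ 2 / ((m n + 1 : ℕ) : ℝ) + 6 * (1 / (m n + 1 : ℕ)) := by gcongr
        _ = _ := by ring
    rw [Equiv.sum_comp (rank n 0).symm fun i => F (linearInterp (m n + 1) (pos n i)), ← mul_sub,
      ← Finset.sum_sub_distrib, dist_zero_right, Real.norm_eq_abs, abs_mul,
      abs_of_pos (by positivity)]
    calc _ ≤ 1 / (n : ℝ) * ∑ _i : Fin n, ε / 2 := by
          gcongr
          exact (Finset.abs_sum_le_sum_abs _ _).trans (Finset.sum_le_sum fun i _ => hclose i)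
      _ = ε / 2 := by
          rw [Finset.sum_const, Finset.card_univ, Fintype.card_fin, nsmul_eq_mul]
          field_simp
      _ < ε := by linarith
  have := (hrank.add hsample).add hdiscrete
  simpa using this
end

section
/- Let X = (X(t); 0 ≤ t ≤ 1) be a permuton process with X(1) = −X(0) almost surely and with energy E(X) = π²/3. Then almost surely X(t) = cos(πt)·X(0) + sin(πt)·X(1/2) for every t ∈ [0,1], and the pair (X(0), X(1/2)) is distributed according to the Archimedean measure; in other words, X is the Archimedean process. -/
open MeasureTheory Set Filter
open scoped ENNReal Real Topology

/-- `t 0 = 0 < t 1 < ... < t k = 1` is a finite partition of [0,1]. -/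
def IsPartition (k : ℕ) (t : ℕ → ℝ) : Prop :=
  0 < k ∧ t 0 = 0 ∧ t k = 1 ∧ ∀ i < k, t i < t (i + 1)

/-- The energy of a path along partitions of [0,1], expressed in terms of the
squared-distance function `D s t` between the points `γ s` and `γ t` of the path:
`E = sup_Π Σ_i d(γ(t_i),γ(t_{i-1}))² / (t_i - t_{i-1})`. -/
noncomputable def energyOf (D : ℝ → ℝ → ℝ) : ℝ≥0∞ :=
  ⨆ (k : ℕ) (t : ℕ → ℝ) (_ : IsPartition k t),
    ENNReal.ofReal (∑ i ∈ Finset.range k, D (t i) (t (i + 1)) / (t (i + 1) - t i))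

/-- The Archimedean measure, with density (2π√(1-x²-y²))⁻¹ on the unit disk. -/
noncomputable def archMeasure : Measure (ℝ × ℝ) :=
  volume.withDensity fun p =>
    ENNReal.ofReal
      (if p.1 ^ 2 + p.2 ^ 2 < 1 then (2 * π * Real.sqrt (1 - p.1 ^ 2 - p.2 ^ 2))⁻¹ else 0)

section Geometry

open InnerProductGeometry

variable {V : Type*} [NormedAddCommGroup V] [InnerProductSpace ℝ V]

lemma angle_le_sum_angle (w : ℕ → V) (hw : ∀ i, w i ≠ 0) (a m : ℕ) :
    angle (w a) (w (a + m)) ≤ ∑ i ∈ Finset.range m, angle (w (a + i)) (w (a + i + 1)) := by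
  induction m with
  | zero => simp [angle_self (hw a)]
  | succ m ih =>
    rw [Finset.sum_range_succ]
    exact (angle_le_angle_add_angle _ (w (a + m)) _).trans (by gcongr; rfl)

lemma sum_sq_angle_block_le (w : ℕ → V) (hw : ∀ i, w i ≠ 0) (n m : ℕ) :
    ∑ j ∈ Finset.range m, angle (w (j * n)) (w ((j + 1) * n)) ^ 2 ≤
      n * ∑ i ∈ Finset.range (m * n), angle (w i) (w (i + 1)) ^ 2 := by
  induction m with
  | zero => simp
  | succ m ih =>
    rw [Finset.sum_range_succ, add_mul, one_mul, Finset.sum_range_add, mul_add]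
    refine add_le_add ih ?_
    calc angle (w (m * n)) (w (m * n + n)) ^ 2
        ≤ (∑ i ∈ Finset.range n, angle (w (m * n + i)) (w (m * n + i + 1))) ^ 2 := by
          gcongr
          · exact angle_nonneg _ _
          · exact angle_le_sum_angle w hw _ _
      _ ≤ n * ∑ i ∈ Finset.range n, angle (w (m * n + i)) (w (m * n + i + 1)) ^ 2 := by
          simpa using sq_sum_le_card_mul_sum_sq (s := Finset.range n)
            (f := fun i => angle (w (m * n + i)) (w (m * n + i + 1)))

lemma sq_sub_le_two_mul_one_sub_cos {θ : ℝ} (h0 : 0 ≤ θ) (hπ : θ ≤ π) :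
    θ ^ 2 * (1 - θ ^ 2 / 12) ≤ 2 * (1 - Real.cos θ) := by
  have h1 := Real.sin_ge_sub_cube (x := θ / 2) (by positivity)
  have h2 : Real.cos θ = 1 - 2 * Real.sin (θ / 2) ^ 2 := by
    rw [Real.sin_sq_eq_half_sub]; ring_nf
  have hθ : θ ≤ 4 := hπ.trans Real.pi_le_four
  have h3 : 0 ≤ θ / 2 - (θ / 2) ^ 3 / 6 := by
    have : 0 ≤ θ * (24 - θ ^ 2) := mul_nonneg h0 (by nlinarith)
    nlinarith
  have h4 := pow_le_pow_left₀ h3 h1 2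
  rw [h2]
  nlinarith [sq_nonneg (θ ^ 3)]

lemma norm_sub_sq_of_norm_eq {r : ℝ} {x y : V} (hx : ‖x‖ = r) (hy : ‖y‖ = r) :
    ‖x - y‖ ^ 2 = r ^ 2 * (2 * (1 - Real.cos (angle x y))) := by
  have := norm_sub_sq_real x y
  rw [← cos_angle_mul_norm_mul_norm, hx, hy] at this
  rw [this]; ring

lemma sum_sq_angle_le_of_chain {r : ℝ} (hr : 0 < r) (w : ℕ → V) (hw : ∀ i, ‖w i‖ = r)
    {N : ℕ} (hN : 0 < N)
    (h : N * ∑ i ∈ Finset.range N, ‖w i - w (i + 1)‖ ^ 2 ≤ r ^ 2 * π ^ 2) :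
    (1 - π ^ 4 / 48 / N) * (N * ∑ i ∈ Finset.range N, angle (w i) (w (i + 1)) ^ 2) ≤ π ^ 2 := by
  have hN' : (0 : ℝ) < N := by exact_mod_cast hN
  simp_rw [fun i => norm_sub_sq_of_norm_eq (hw i) (hw (i + 1))] at h
  rw [← Finset.mul_sum, mul_left_comm, mul_le_mul_iff_right₀ (by positivity)] at h
  refine le_trans ?_ h
  rw [mul_left_comm, Finset.mul_sum]
  refine mul_le_mul_of_nonneg_left (Finset.sum_le_sum fun i hi => ?_) hN'.le
  set θ := angle (w i) (w (i + 1))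
  have h0 : 0 ≤ θ := angle_nonneg _ _
  have hπ : θ ≤ π := angle_le_pi _ _
  refine le_trans ?_ (sq_sub_le_two_mul_one_sub_cos h0 hπ)
  rw [mul_comm]
  refine mul_le_mul_of_nonneg_left (sub_le_sub_left ?_ _) (sq_nonneg _)
  have hsingle : 2 * (1 - Real.cos θ) ≤
      ∑ i ∈ Finset.range N, 2 * (1 - Real.cos (angle (w i) (w (i + 1)))) :=
    Finset.single_le_sum (f := fun i => 2 * (1 - Real.cos (angle (w i) (w (i + 1)))))
      (fun j _ => by have := Real.cos_le_one (angle (w j) (w (j + 1))); linarith) hi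
  have hjordan := Real.cos_le_one_sub_mul_cos_sq (abs_le.2 ⟨by linarith, hπ⟩)
  have hb : N * (2 * (2 / π ^ 2 * θ ^ 2)) ≤ π ^ 2 :=
    le_trans (by gcongr; linarith) h
  have : N * θ ^ 2 ≤ π ^ 4 / 4 := by
    have e : N * (2 * (2 / π ^ 2 * θ ^ 2)) = 4 * (N * θ ^ 2) / π ^ 2 := by ring
    rw [e, div_le_iff₀ (by positivity)] at hb
    nlinarith
  rw [div_div, div_le_div_iff₀ (by norm_num) (by positivity)]
  nlinarith

lemma sum_sq_angle_le {r : ℝ} (hr : 0 < r) (γ : ℝ → V) (hγ : ∀ t, ‖γ t‖ = r)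
    (h : ∀ N : ℕ, 0 < N → N * ∑ i ∈ Finset.range N,
      ‖γ (i / N) - γ ((i + 1 : ℕ) / N)‖ ^ 2 ≤ r ^ 2 * π ^ 2) {M : ℕ} (hM : 0 < M) :
    M * ∑ j ∈ Finset.range M, angle (γ (j / M)) (γ ((j + 1 : ℕ) / M)) ^ 2 ≤ π ^ 2 := by
  set S := M * ∑ j ∈ Finset.range M, angle (γ (j / M)) (γ ((j + 1 : ℕ) / M)) ^ 2
  have hM' : (M : ℝ) ≠ 0 := by exact_mod_cast hM.ne'
  have hne : ∀ t, γ t ≠ 0 := fun t => norm_ne_zero_iff.1 (by rw [hγ t]; exact hr.ne')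
  have hN : Tendsto (fun n : ℕ => M * n) atTop atTop := tendsto_id.const_mul_atTop' hM
  have hlim : Tendsto (fun n : ℕ => (1 - π ^ 4 / 48 / ((M * n : ℕ) : ℝ)) * S) atTop (𝓝 S) := by
    have := ((tendsto_const_div_atTop_nhds_zero_nat (π ^ 4 / 48)).comp hN).const_sub 1
    simpa using this.mul_const S
  refine le_of_tendsto hlim ?_
  filter_upwards [eventually_gt_atTop 0,
    (((tendsto_const_div_atTop_nhds_zero_nat (π ^ 4 / 48)).comp hN).eventually_le_const
      zero_lt_one)] with n hn hle
  have hn' : (n : ℝ) ≠ 0 := by exact_mod_cast hn.ne'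
  have hpos : 0 < M * n := Nat.mul_pos hM hn
  refine le_trans ?_ (sum_sq_angle_le_of_chain hr (fun i => γ (i / (M * n : ℕ)))
    (fun i => hγ _) hpos (h _ hpos))
  refine mul_le_mul_of_nonneg_left ?_ (sub_nonneg.2 hle)
  have hblock := sum_sq_angle_block_le (fun i => γ (i / (M * n : ℕ))) (fun i => hne _) n M
  have hgrid : ∀ j : ℕ, ((j * n : ℕ) : ℝ) / ((M * n : ℕ) : ℝ) = j / M := fun j => by
    push_cast; field_simp
  simp_rw [hgrid] at hblock
  calc S ≤ M * (n * ∑ i ∈ Finset.range (M * n), angle (γ (i / (M * n : ℕ)))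
        (γ ((i + 1 : ℕ) / (M * n : ℕ))) ^ 2) :=
        mul_le_mul_of_nonneg_left hblock (Nat.cast_nonneg M)
    _ = _ := by push_cast; ring

/-- A curve on a sphere joining antipodal points with minimal energy moves along each grid with
angular speed at most `π`. -/
lemma angle_le_of_antipodal {r : ℝ} (hr : 0 < r) (γ : ℝ → V)
    (hγ : ∀ t, ‖γ t‖ = r) (hanti : γ 1 = -γ 0)
    (h : ∀ N : ℕ, 0 < N → N * ∑ i ∈ Finset.range N,
      ‖γ (i / N) - γ ((i + 1 : ℕ) / N)‖ ^ 2 ≤ r ^ 2 * π ^ 2) {M : ℕ} (hM : 0 < M)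
    {j k : ℕ} (hjk : j ≤ k) (hk : k ≤ M) :
    angle (γ (j / M)) (γ (k / M)) ≤ π * ((k : ℝ) / M - j / M) := by
  have hM' : (0 : ℝ) < M := by exact_mod_cast hM
  have hne : ∀ t, γ t ≠ 0 := fun t => norm_ne_zero_iff.1 (by rw [hγ t]; exact hr.ne')
  have hsq := sum_sq_angle_le hr γ hγ h hM
  have hchain := fun a m => angle_le_sum_angle (fun i => γ (i / M)) (fun i => hne _) a m
  set φ : ℕ → ℝ := fun j => angle (γ (j / M)) (γ ((j + 1 : ℕ) / M)) with hφ
  have hsum : π ≤ ∑ i ∈ Finset.range M, φ i := by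
    have := hchain 0 M
    simpa [hφ, hM'.ne', hanti, angle_self_neg_of_nonzero (hne 0)] using this
  have hzero : ∑ i ∈ Finset.range M, (φ i - π / M) ^ 2 ≤ 0 := by
    have e : ∑ i ∈ Finset.range M, (φ i - π / M) ^ 2 =
        (M * ∑ i ∈ Finset.range M, φ i ^ 2 - π ^ 2
          - 2 * π * (∑ i ∈ Finset.range M, φ i - π)) / M := by
      simp_rw [sub_sq, Finset.sum_add_distrib, Finset.sum_sub_distrib, ← Finset.sum_mul,
        ← Finset.mul_sum]
      simp
      field_simp
      ring
    rw [e]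
    refine div_nonpos_of_nonpos_of_nonneg ?_ hM'.le
    nlinarith [Real.pi_pos]
  have hφi : ∀ i < M, φ i = π / M := by
    intro i hi
    have := (Finset.sum_eq_zero_iff_of_nonneg (fun i _ => sq_nonneg _)).1
      (le_antisymm hzero (Finset.sum_nonneg fun i _ => sq_nonneg _)) i (Finset.mem_range.2 hi)
    exact sub_eq_zero.1 (pow_eq_zero_iff two_ne_zero |>.1 this)
  obtain ⟨m, rfl⟩ := Nat.exists_eq_add_of_le hjk
  calc angle (γ (j / M)) (γ ((j + m : ℕ) / M)) ≤ ∑ i ∈ Finset.range m, φ (j + i) := hchain j m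
    _ = ∑ i ∈ Finset.range m, π / M :=
        Finset.sum_congr rfl fun i hi => hφi _ (by have := Finset.mem_range.1 hi; omega)
    _ = π * (((j + m : ℕ) : ℝ) / M - j / M) := by simp; ring

/-- A curve on a sphere joining antipodal points with minimal energy is, at rational times, a
great circle traversed at constant speed. -/
lemma eq_cos_smul_add_sin_smul_of_antipodal {r : ℝ} (hr : 0 < r) (γ : ℝ → V)
    (hγ : ∀ t, ‖γ t‖ = r) (hanti : γ 1 = -γ 0)
    (h : ∀ N : ℕ, 0 < N → N * ∑ i ∈ Finset.range N,
      ‖γ (i / N) - γ ((i + 1 : ℕ) / N)‖ ^ 2 ≤ r ^ 2 * π ^ 2)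
    (q : ℚ) (hq : (q : ℝ) ∈ Icc (0 : ℝ) 1) :
    γ q = Real.cos (π * q) • γ 0 + Real.sin (π * q) • γ (1 / 2) := by
  have hq0 : 0 ≤ q := by exact_mod_cast hq.1
  obtain ⟨a, b, hb, hqab⟩ : ∃ a b : ℕ, 0 < b ∧ (q : ℝ) = a / b :=
    ⟨q.num.toNat, q.den, q.den_pos, by
      rw [Rat.cast_def]
      congr 1
      exact_mod_cast (Int.toNat_of_nonneg (Rat.num_nonneg.2 hq0)).symm⟩
  have hb' : (0 : ℝ) < b := by exact_mod_cast hb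
  have hgrid : ((2 * a : ℕ) : ℝ) / ((2 * b : ℕ) : ℝ) = q := by
    rw [hqab]; push_cast; field_simp
  have hhalf : ((b : ℕ) : ℝ) / ((2 * b : ℕ) : ℝ) = 1 / 2 := by push_cast; field_simp
  have hone : ((2 * b : ℕ) : ℝ) / ((2 * b : ℕ) : ℝ) = 1 := by push_cast; field_simp
  have hab : a ≤ b := by
    have := hq.2
    rw [hqab, div_le_one hb'] at this
    exact_mod_cast this
  have hang := fun j k => angle_le_of_antipodal hr γ hγ hanti h (M := 2 * b) (by omega)
    (j := j) (k := k)
  have hstart : ∀ k ≤ 2 * b, angle (γ 0) (γ (k / (2 * b : ℕ))) = π * (k / (2 * b : ℕ)) := by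
    intro k hk
    have h1 := hang 0 k (Nat.zero_le _) hk
    have h2 := hang k (2 * b) hk le_rfl
    rw [hone, hanti, angle_neg_right, angle_comm] at h2
    simp only [Nat.cast_zero, zero_div, sub_zero] at h1
    linarith
  have hinner : ∀ x y, inner ℝ (γ x) (γ y) = r ^ 2 * Real.cos (angle (γ x) (γ y)) := by
    intro x y
    rw [← cos_angle_mul_norm_mul_norm, hγ, hγ]; ring
  have h0q : inner ℝ (γ 0) (γ q) = r ^ 2 * Real.cos (π * q) := by
    rw [hinner, ← hgrid, hstart _ (by omega)]
  have h0h : inner ℝ (γ 0) (γ (1 / 2)) = 0 := by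
    rw [hinner, ← hhalf, hstart _ (by omega), hhalf, mul_one_div, Real.cos_pi_div_two, mul_zero]
  have hsin : Real.sin (π * q) = Real.cos (π * (1 / 2 - q)) := by
    rw [← Real.cos_pi_div_two_sub]; ring_nf
  have hqh : r ^ 2 * Real.sin (π * q) ≤ inner ℝ (γ q) (γ (1 / 2)) := by
    rw [hinner, hsin]
    gcongr
    have hdist : angle (γ q) (γ (1 / 2)) ≤ |π * (1 / 2 - q)| := by
      rcases le_total (2 * a) b with hle | hle
      · have := hang (2 * a) b hle (by omega)
        rw [hgrid, hhalf] at this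
        exact this.trans (le_abs_self _)
      · have := hang b (2 * a) hle (by omega)
        rw [hgrid, hhalf, angle_comm] at this
        exact this.trans (le_trans (by linarith) (neg_le_abs _))
    rw [← Real.cos_abs (π * (1 / 2 - q))]
    refine Real.cos_le_cos_of_nonneg_of_le_pi (angle_nonneg _ _) ?_ hdist
    rw [abs_le]
    constructor <;> nlinarith [hq.1, hq.2, Real.pi_pos]
  have hsin0 : 0 ≤ Real.sin (π * q) :=
    Real.sin_nonneg_of_nonneg_of_le_pi (mul_nonneg Real.pi_pos.le hq.1)
      (by nlinarith [hq.2, Real.pi_pos])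
  have hsc := Real.sin_sq_add_cos_sq (π * q)
  set c := Real.cos (π * q)
  set s := Real.sin (π * q)
  rw [← sub_eq_zero, ← norm_eq_zero, ← pow_eq_zero_iff two_ne_zero]
  refine le_antisymm ?_ (sq_nonneg _)
  rw [norm_sub_sq_real, norm_add_sq_real, inner_add_right, inner_smul_right, inner_smul_right,
    inner_smul_left, inner_smul_right, norm_smul, norm_smul, hγ, hγ, hγ, h0h, mul_pow, mul_pow,
    real_inner_comm, h0q, Real.norm_eq_abs, Real.norm_eq_abs, sq_abs, sq_abs]
  have hprod := mul_le_mul_of_nonneg_left hqh hsin0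
  simp only [mul_zero, add_zero]
  nlinarith

end Geometry

section Archimedean

/-- The density of the Archimedean measure with respect to Lebesgue measure. -/
noncomputable def archDensity (p : ℝ × ℝ) : ℝ≥0∞ :=
  ENNReal.ofReal
    (if p.1 ^ 2 + p.2 ^ 2 < 1 then (2 * π * Real.sqrt (1 - p.1 ^ 2 - p.2 ^ 2))⁻¹ else 0)

lemma archMeasure_eq : archMeasure = volume.withDensity archDensity := rfl

lemma measurable_archDensity : Measurable archDensity := by
  refine ENNReal.measurable_ofReal.comp (Measurable.ite ?_ (by fun_prop) measurable_const)
  exact measurableSet_lt (by fun_prop) measurable_const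

lemma lintegral_archDensity_section {x : ℝ} (hx : x ^ 2 < 1) :
    ∫⁻ y, archDensity (x, y) = 2⁻¹ := by
  have hc2 : 0 < 1 - x ^ 2 := by linarith
  set c := √(1 - x ^ 2) with hc
  have hc0 : 0 < c := Real.sqrt_pos.2 hc2
  have hcsq : c ^ 2 = 1 - x ^ 2 := Real.sq_sqrt hc2.le
  set g' : ℝ → ℝ := fun y => (2 * π * √(1 - x ^ 2 - y ^ 2))⁻¹ with hg'
  have hcont : ContinuousOn (fun y => Real.arcsin (y / c) / (2 * π)) (Icc (-c) c) := by
    fun_prop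
  have hderiv : ∀ y ∈ Ioo (-c) c,
      HasDerivAt (fun y => Real.arcsin (y / c) / (2 * π)) (g' y) y := by
    intro y hy
    have h1 : y / c ≠ -1 := fun h => by rw [div_eq_iff hc0.ne'] at h; linarith [hy.1]
    have h2 : y / c ≠ 1 := fun h => by rw [div_eq_iff hc0.ne'] at h; linarith [hy.2]
    have hd := (((Real.hasDerivAt_arcsin h1 h2).comp y
      ((hasDerivAt_id y).div_const c)).div_const (2 * π))
    refine hd.congr_deriv ?_
    have : 1 - x ^ 2 - y ^ 2 = c ^ 2 * (1 - (y / c) ^ 2) := by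
      rw [← hcsq]; field_simp
    rw [hg']
    simp only [this]
    rw [Real.sqrt_mul (sq_nonneg c), Real.sqrt_sq hc0.le, mul_inv, mul_inv, mul_inv]
    field_simp
  have hpos : ∀ y, 0 ≤ g' y := fun y => by positivity
  have hint := intervalIntegral.integrableOn_deriv_of_nonneg hcont hderiv fun y _ => hpos y
  have hle : -c ≤ c := by linarith
  have hval : ∫ y in Ioc (-c) c, g' y = 1 / 2 := by
    rw [← intervalIntegral.integral_of_le hle,
      intervalIntegral.integral_eq_sub_of_hasDerivAt_of_le hle hcont hderiv
        ((intervalIntegrable_iff_integrableOn_Ioc_of_le hle).2 hint)]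
    rw [neg_div, div_self hc0.ne', Real.arcsin_neg, Real.arcsin_one]
    field_simp
    ring
  have hind : (fun y => archDensity (x, y)) =
      (Ioo (-c) c).indicator fun y => ENNReal.ofReal (g' y) := by
    ext y
    by_cases hy : y ∈ Ioo (-c) c
    · have : x ^ 2 + y ^ 2 < 1 := by nlinarith [hy.1, hy.2]
      simp [archDensity, hy, this, hg']
    · have : ¬ x ^ 2 + y ^ 2 < 1 := fun h => hy (abs_lt.1 (abs_lt_of_sq_lt_sq (by linarith) hc0.le))
      simp [archDensity, hy, this]
  rw [hind, lintegral_indicator measurableSet_Ioo, setLIntegral_congr Ioo_ae_eq_Ioc,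
    ← ofReal_integral_eq_lintegral_ofReal hint (Eventually.of_forall hpos), hval]
  simp [ENNReal.ofReal_inv_of_pos]

lemma map_fst_archMeasure : archMeasure.map Prod.fst = unif := by
  ext s hs
  rw [Measure.map_apply measurable_fst hs, archMeasure_eq,
    withDensity_apply _ (measurable_fst hs), ← lintegral_indicator (measurable_fst hs),
    Measure.volume_eq_prod,
    lintegral_prod _ (measurable_archDensity.indicator (measurable_fst hs)).aemeasurable]
  have : ∀ x : ℝ, ∫⁻ y, (Prod.fst ⁻¹' s).indicator archDensity (x, y) =
      (s ∩ Ioo (-1) 1).indicator (fun _ => 2⁻¹) x := by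
    intro x
    by_cases hxs : x ∈ s
    · by_cases hx : x ∈ Ioo (-1 : ℝ) 1
      · have : x ^ 2 < 1 := by nlinarith [hx.1, hx.2]
        simp [indicator, hxs, hx.1, hx.2, lintegral_archDensity_section this]
      · have h1 : ∀ y : ℝ, ¬ x ^ 2 + y ^ 2 < 1 := fun y h =>
          hx (abs_lt.1 (abs_lt_of_sq_lt_sq (by nlinarith [sq_nonneg y]) zero_le_one))
        rw [indicator_of_notMem fun h => hx h.2]
        simp [indicator, hxs, archDensity, h1]
    · simp [indicator, hxs]
  simp_rw [this]
  rw [lintegral_indicator_const (hs.inter measurableSet_Ioo), unif, Measure.smul_apply,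
    Measure.restrict_apply hs, smul_eq_mul]
  congr 1
  exact measure_congr ((ae_eq_refl s).inter Ioo_ae_eq_Icc)

instance : IsProbabilityMeasure unif := by
  constructor
  simp only [unif, Measure.smul_apply, Measure.restrict_apply_univ, Real.volume_Icc, smul_eq_mul]
  norm_num
  exact ENNReal.inv_mul_cancel two_ne_zero ENNReal.ofNat_ne_top

instance : IsProbabilityMeasure archMeasure := by
  constructor
  rw [← preimage_univ (f := Prod.fst), ← Measure.map_apply measurable_fst MeasurableSet.univ,
    map_fst_archMeasure, measure_univ]

lemma measurePreserving_rotation (φ : ℝ) :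
    MeasurePreserving (fun p : ℝ × ℝ =>
      (Real.cos φ * p.1 + Real.sin φ * p.2, -Real.sin φ * p.1 + Real.cos φ * p.2)) := by
  have := Complex.volume_preserving_equiv_real_prod.comp
    ((rotation (Circle.exp (-φ))).measurePreserving.comp
      (Complex.volume_preserving_equiv_real_prod.symm _))
  convert this using 1
  have hexp : ((Circle.exp (-φ) : Circle) : ℂ) = ⟨Real.cos φ, -Real.sin φ⟩ := by
    rw [Circle.coe_exp]
    apply Complex.ext <;> simp [Complex.exp_re, Complex.exp_im]
  ext p
  · simp only [Function.comp_apply, rotation_apply, hexp,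
      Complex.measurableEquivRealProd_symm_apply, Complex.measurableEquivRealProd_apply,
      Complex.mul_re]
    ring
  · simp only [Function.comp_apply, rotation_apply, hexp,
      Complex.measurableEquivRealProd_symm_apply, Complex.measurableEquivRealProd_apply,
      Complex.mul_im]
    ring

lemma measurePreserving_rotation_archMeasure (φ : ℝ) :
    MeasurePreserving (fun p : ℝ × ℝ =>
      (Real.cos φ * p.1 + Real.sin φ * p.2, -Real.sin φ * p.1 + Real.cos φ * p.2))
      archMeasure archMeasure := by
  have hR := measurePreserving_rotation φ
  set R := fun p : ℝ × ℝ =>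
      (Real.cos φ * p.1 + Real.sin φ * p.2, -Real.sin φ * p.1 + Real.cos φ * p.2) with hRdef
  have hnorm : ∀ p, (R p).1 ^ 2 + (R p).2 ^ 2 = p.1 ^ 2 + p.2 ^ 2 := fun p => by
    have := Real.sin_sq_add_cos_sq φ
    simp only [hRdef]
    linear_combination (p.1 ^ 2 + p.2 ^ 2) * this
  have hdens : ∀ p, archDensity (R p) = archDensity p := fun p => by
    simp only [archDensity, sub_sub, hnorm]
  refine ⟨hR.measurable, ?_⟩
  ext s hs
  rw [Measure.map_apply hR.measurable hs, archMeasure_eq, withDensity_apply _ hs,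
    withDensity_apply _ (hR.measurable hs),
    ← hR.setLIntegral_comp_preimage hs measurable_archDensity]
  simp_rw [hdens]

lemma map_projection_archMeasure (φ : ℝ) :
    archMeasure.map (fun p => Real.cos φ * p.1 + Real.sin φ * p.2) = unif := by
  have hR := measurePreserving_rotation_archMeasure φ
  rw [← map_fst_archMeasure]
  conv_rhs => rw [← hR.map_eq, Measure.map_map measurable_fst hR.measurable]
  rfl

/-- A finite measure on the plane is determined by its projections onto lines through the
origin. -/
lemma ext_of_map_projection {μ ν : Measure (ℝ × ℝ)} [IsFiniteMeasure μ] [IsFiniteMeasure ν]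
    (h : ∀ φ ∈ Icc 0 π, μ.map (fun p => Real.cos φ * p.1 + Real.sin φ * p.2) =
      ν.map (fun p => Real.cos φ * p.1 + Real.sin φ * p.2)) : μ = ν := by
  refine Measure.ext_of_charFunDual (funext fun L => ?_)
  obtain ⟨ρ, φ, hφ, h1, h2⟩ : ∃ ρ φ : ℝ, φ ∈ Icc 0 π ∧ L (1, 0) = ρ * Real.cos φ ∧
      L (0, 1) = ρ * Real.sin φ := by
    set z : ℂ := ⟨L (1, 0), L (0, 1)⟩
    have hz1 : ‖z‖ * Real.cos z.arg = L (1, 0) := Complex.norm_mul_cos_arg z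
    have hz2 : ‖z‖ * Real.sin z.arg = L (0, 1) := Complex.norm_mul_sin_arg z
    rcases le_total 0 z.arg with h0 | h0
    · exact ⟨‖z‖, z.arg, ⟨h0, Complex.arg_le_pi z⟩, hz1.symm, hz2.symm⟩
    · refine ⟨-‖z‖, z.arg + π, ⟨by linarith [Complex.neg_pi_lt_arg z], by linarith⟩, ?_, ?_⟩
      · rw [Real.cos_add_pi, neg_mul_neg, hz1]
      · rw [Real.sin_add_pi, neg_mul_neg, hz2]
  have hL : ⇑L = (fun x => ρ * x) ∘ fun p => Real.cos φ * p.1 + Real.sin φ * p.2 := by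
    ext p
    have : p = p.1 • ((1 : ℝ), (0 : ℝ)) + p.2 • ((0 : ℝ), (1 : ℝ)) := by ext <;> simp
    conv_lhs => rw [this, map_add, map_smul, map_smul, h1, h2]
    simp only [smul_eq_mul, Function.comp_apply]
    ring
  rw [charFunDual_eq_charFun_map_one, charFunDual_eq_charFun_map_one, hL,
    ← Measure.map_map (by fun_prop) (by fun_prop), ← Measure.map_map (by fun_prop) (by fun_prop),
    h φ hφ]

end Archimedean

lemma integral_sq_unif : ∫ x, x ^ 2 ∂unif = 1 / 3 := by
  rw [unif, integral_smul_measure, integral_Icc_eq_integral_Ioc,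
    ← intervalIntegral.integral_of_le (by norm_num), integral_pow]
  norm_num

lemma norm_toLp_two_sq {Ω : Type*} [MeasurableSpace Ω] {P : Measure Ω} {f : Ω → ℝ}
    (hf : MemLp f 2 P) : ‖hf.toLp f‖ ^ 2 = ∫ ω, f ω ^ 2 ∂P := by
  rw [← real_inner_self_eq_norm_sq, L2.inner_def]
  refine integral_congr_ae ?_
  filter_upwards [hf.coeFn_toLp] with ω hω
  simp [hω, sq]

lemma sum_div_le_of_energyOf_le {D : ℝ → ℝ → ℝ} {E : ℝ} (hE : 0 ≤ E)
    (h : energyOf D ≤ ENNReal.ofReal E) {k : ℕ} {t : ℕ → ℝ} (ht : IsPartition k t) :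
    ∑ i ∈ Finset.range k, D (t i) (t (i + 1)) / (t (i + 1) - t i) ≤ E := by
  rw [← ENNReal.ofReal_le_ofReal_iff hE]
  refine le_trans ?_ h
  unfold energyOf
  exact le_iSup_of_le k (le_iSup_of_le t (le_iSup_of_le ht le_rfl))

lemma isPartition_uniform {N : ℕ} (hN : 0 < N) : IsPartition N fun i => (i : ℝ) / N := by
  have hN' : (0 : ℝ) < N := by exact_mod_cast hN
  refine ⟨hN, by simp, div_self hN'.ne', fun i _ => ?_⟩
  exact div_lt_div_of_pos_right (by exact_mod_cast i.lt_succ_self) hN'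

lemma aemeasurable_of_map_eq {α β : Type*} [MeasurableSpace α] [MeasurableSpace β]
    {μ : Measure α} {ν : Measure β} [NeZero ν] {f : α → β} (h : μ.map f = ν) :
    AEMeasurable f μ := by
  by_contra hf
  exact NeZero.ne ν (by rw [← h, Measure.map_of_not_aemeasurable hf])

/-- a permuton process X with X(1) = -X(0) a.s. and energy exactly π²/3
is the Archimedean process: a.s. X(t) = cos(πt)X(0) + sin(πt)X(1/2) for all t, and
(X(0), X(1/2)) has the Archimedean distribution. -/
theorem permuton_process_energy_eq_iff_archimedean
    {Ω : Type*} [MeasurableSpace Ω] (P : Measure Ω) [IsProbabilityMeasure P]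
    (X : ℝ → Ω → ℝ)
    (hcont : ∀ ω, ContinuousOn (fun t => X t ω) (Icc 0 1))
    (hval : ∀ t ∈ Icc (0:ℝ) 1, ∀ ω, X t ω ∈ Icc (-1 : ℝ) 1)
    (hunif : ∀ t ∈ Icc (0:ℝ) 1, P.map (X t) = unif)
    (hrev : ∀ᵐ ω ∂P, X 1 ω = -X 0 ω)
    (henergy : energyOf (fun s t => ∫ ω, (X t ω - X s ω) ^ 2 ∂P) =
      ENNReal.ofReal (π ^ 2 / 3)) :
    (∀ᵐ ω ∂P, ∀ t ∈ Icc (0:ℝ) 1,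
        X t ω = Real.cos (π * t) * X 0 ω + Real.sin (π * t) * X (1 / 2) ω) ∧
      P.map (fun ω => (X 0 ω, X (1 / 2) ω)) = archMeasure := by
  have hm : ∀ t ∈ Icc (0 : ℝ) 1, AEMeasurable (X t) P := fun t ht =>
    aemeasurable_of_map_eq (hunif t ht)
  set c : ℝ → ℝ := fun t => projIcc (0 : ℝ) 1 zero_le_one t with hc
  have hcmem : ∀ t, c t ∈ Icc (0 : ℝ) 1 := fun t => (projIcc (0 : ℝ) 1 zero_le_one t).2
  have hcid : ∀ t ∈ Icc (0 : ℝ) 1, c t = t := fun t ht => by simp [hc, projIcc_of_mem _ ht]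
  have hL : ∀ t, MemLp (X (c t)) 2 P := fun t =>
    MemLp.of_bound (hm _ (hcmem t)).aestronglyMeasurable 1
      (Eventually.of_forall fun ω => abs_le.2 (hval _ (hcmem t) ω))
  set γ : ℝ → Lp ℝ 2 P := fun t => (hL t).toLp _ with hγdef
  have hr : 0 < √(1 / 3 : ℝ) := by positivity
  have hγ : ∀ t, ‖γ t‖ = √(1 / 3) := by
    intro t
    rw [← Real.sqrt_sq (norm_nonneg (γ t)), norm_toLp_two_sq, ← integral_sq_unif,
      ← hunif _ (hcmem t), integral_map (hm _ (hcmem t)) (by fun_prop)]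
  have hzero : (0 : ℝ) ∈ Icc (0 : ℝ) 1 := by simp
  have hone : (1 : ℝ) ∈ Icc (0 : ℝ) 1 := by simp
  have hhalf : (1 / 2 : ℝ) ∈ Icc (0 : ℝ) 1 := by constructor <;> norm_num
  have hanti : γ 1 = -γ 0 := by
    rw [← MemLp.toLp_neg, MemLp.toLp_eq_toLp_iff, hcid 0 hzero, hcid 1 hone]
    exact hrev
  have hE : ∀ N : ℕ, 0 < N → N * ∑ i ∈ Finset.range N,
      ‖γ (i / N) - γ ((i + 1 : ℕ) / N)‖ ^ 2 ≤ √(1 / 3) ^ 2 * π ^ 2 := by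
    intro N hN
    have hN' : (0 : ℝ) < N := by exact_mod_cast hN
    have hsum := sum_div_le_of_energyOf_le (by positivity) henergy.le (isPartition_uniform hN)
    rw [Real.sq_sqrt (by norm_num), Finset.mul_sum]
    refine le_trans (Finset.sum_le_sum fun i hi => ?_) (hsum.trans_eq (by ring))
    have hi : i < N := Finset.mem_range.1 hi
    have hmem : ∀ j ≤ N, (j : ℝ) / N ∈ Icc (0 : ℝ) 1 := fun j hj =>
      ⟨by positivity, div_le_one_of_le₀ (by exact_mod_cast hj) hN'.le⟩
    rw [norm_sub_rev, ← MemLp.toLp_sub, norm_toLp_two_sq]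
    simp only [Pi.sub_apply]
    rw [hcid _ (hmem i hi.le), hcid _ (hmem (i + 1) hi)]
    have : ((i + 1 : ℕ) : ℝ) / N - i / N = 1 / N := by push_cast; ring
    rw [this, div_div_eq_mul_div, div_one, mul_comm]
  have hrat : ∀ q : ℚ, (q : ℝ) ∈ Icc (0 : ℝ) 1 → ∀ᵐ ω ∂P,
      X q ω = Real.cos (π * q) * X 0 ω + Real.sin (π * q) * X (1 / 2) ω := by
    intro q hq
    have h := eq_cos_smul_add_sin_smul_of_antipodal hr γ hγ hanti hE q hq
    rw [← MemLp.toLp_const_smul, ← MemLp.toLp_const_smul, ← MemLp.toLp_add,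
      MemLp.toLp_eq_toLp_iff, hcid q hq, hcid 0 hzero, hcid _ hhalf] at h
    exact h
  have hpath : ∀ᵐ ω ∂P, ∀ t ∈ Icc (0 : ℝ) 1,
      X t ω = Real.cos (π * t) * X 0 ω + Real.sin (π * t) * X (1 / 2) ω := by
    have hall : ∀ᵐ ω ∂P, ∀ q : ℚ, (q : ℝ) ∈ Icc (0 : ℝ) 1 →
        X q ω = Real.cos (π * q) * X 0 ω + Real.sin (π * q) * X (1 / 2) ω := by
      simpa only [ae_all_iff] using hrat
    filter_upwards [hall] with ω hω
    have hsub : Icc (0 : ℝ) 1 ⊆ closure (Ioo 0 1 ∩ range ((↑) : ℚ → ℝ)) := by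
      rw [← closure_Ioo zero_ne_one]
      exact closure_minimal (Rat.denseRange_cast.open_subset_closure_inter isOpen_Ioo)
        isClosed_closure
    refine EqOn.of_subset_closure (s := Ioo 0 1 ∩ range ((↑) : ℚ → ℝ)) ?_ (hcont ω)
      (by fun_prop) (fun x hx => Ioo_subset_Icc_self hx.1) hsub
    rintro _ ⟨hx, q, rfl⟩
    exact hω q (Ioo_subset_Icc_self hx)
  refine ⟨hpath, ?_⟩
  have hpair : AEMeasurable (fun ω => (X 0 ω, X (1 / 2) ω)) P := (hm 0 hzero).prodMk (hm _ hhalf)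
  have : IsProbabilityMeasure (P.map fun ω => (X 0 ω, X (1 / 2) ω)) :=
    Measure.isProbabilityMeasure_map hpair
  refine ext_of_map_projection fun φ hφ => ?_
  have ht : φ / π ∈ Icc (0 : ℝ) 1 :=
    ⟨div_nonneg hφ.1 Real.pi_pos.le, div_le_one_of_le₀ hφ.2 Real.pi_pos.le⟩
  rw [map_projection_archMeasure, AEMeasurable.map_map_of_aemeasurable (by fun_prop) hpair,
    ← hunif _ ht]
  refine Measure.map_congr ?_
  filter_upwards [hpath] with ω hω
  rw [hω _ ht, mul_div_cancel₀ _ Real.pi_ne_zero]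
  rfl
end

section
/- Let (K,d) be a compact metric space and let γ = (γ(t); 0 ≤ t ≤ 1) be a path in the space of Borel probability measures on K with finite energy with respect to the 2-Wasserstein distance. Then there exists a K-valued stochastic process X = (X(t); 0 ≤ t ≤ 1) with continuous sample paths such that X(t) ~ γ(t) for every t, and the energy of X with respect to the L² metric d_{L²}(X(t),X(s)) = E[d(X(t),X(s))²]^{1/2} equals the energy of γ. -/
open MeasureTheory Set Filter
open scoped ENNReal Real Topology

/-- Optimal transportation cost between two measures for the cost `c`. -/
noncomputable def W2sqCost {K : Type*} [MeasurableSpace K] (c : K × K → ℝ)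
    (μ ν : Measure K) : ℝ :=
  sInf {e | ∃ m : Measure (K × K), IsProbabilityMeasure m ∧
    m.map Prod.fst = μ ∧ m.map Prod.snd = ν ∧ e = ∫ p, c p ∂m}

/-- The squared 2-Wasserstein distance on a metric space:
`W₂(μ,ν)² = inf over couplings of E[d(V,W)²]`. -/
noncomputable def W2sq {K : Type*} [MeasurableSpace K] [PseudoMetricSpace K]
    (μ ν : Measure K) : ℝ :=
  W2sqCost (fun p => dist p.1 p.2 ^ 2) μ ν

open ProbabilityTheory

section Gluing

variable {α β : Type*} [MeasurableSpace α] [MeasurableSpace β]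

lemma map_compProd_comap {δ : Type*} [MeasurableSpace δ] (Q : Measure α) [SFinite Q]
    {f : α → β} (hf : Measurable f) (κ : Kernel β δ) [IsMarkovKernel κ] :
    (Q ⊗ₘ κ.comap f hf).map (fun p => (f p.1, p.2)) = (Q.map f) ⊗ₘ κ := by
  ext s hs
  rw [Measure.map_apply (by fun_prop) hs,
    Measure.compProd_apply (hs.preimage (by fun_prop)), Measure.compProd_apply hs,
    lintegral_map (Kernel.measurable_kernel_prodMk_left hs) hf]
  rfl

/-- Consecutive couplings `m i` of `μ i` and `μ (i + 1)` can be glued into the law of a sequence. -/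
lemma exists_glued_measure [StandardBorelSpace β] [Nonempty β] (μ : ℕ → Measure β)
    (m : ℕ → Measure (β × β)) [IsProbabilityMeasure (μ 0)] (k : ℕ)
    (hm : ∀ i < k, IsProbabilityMeasure (m i)) (hfst : ∀ i < k, (m i).map Prod.fst = μ i)
    (hsnd : ∀ i < k, (m i).map Prod.snd = μ (i + 1)) :
    ∃ Q : Measure (ℕ → β), IsProbabilityMeasure Q ∧ (∀ i ≤ k, Q.map (fun x => x i) = μ i) ∧
      ∀ i < k, Q.map (fun x => (x i, x (i + 1))) = m i := by
  induction k with
  | zero =>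
    refine ⟨(μ 0).map (fun x _ => x), Measure.isProbabilityMeasure_map (by fun_prop), ?_, by simp⟩
    intro i hi
    obtain rfl : i = 0 := by omega
    rw [Measure.map_map (by fun_prop) (by fun_prop)]
    exact Measure.map_id
  | succ k ih =>
    obtain ⟨Q, hQ, hmarg, hpair⟩ := ih (fun i hi => hm i (by omega)) (fun i hi => hfst i (by omega))
      (fun i hi => hsnd i (by omega))
    have := hm k (by omega)
    obtain ⟨R, hR, hR1, hlast⟩ : ∃ R : Measure ((ℕ → β) × β), IsProbabilityMeasure R ∧
        R.map Prod.fst = Q ∧ R.map (fun p => (p.1 k, p.2)) = m k := by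
      refine ⟨Q ⊗ₘ (m k).condKernel.comap (fun x : ℕ → β => x k) (measurable_pi_apply k),
        inferInstance, Measure.fst_compProd _ _, ?_⟩
      rw [map_compProd_comap Q (measurable_pi_apply k), hmarg k le_rfl, ← hfst k (by omega)]
      exact Measure.disintegrate _ _
    have hupd : Measurable fun p : (ℕ → β) × β => Function.update p.1 (k + 1) p.2 := by
      refine measurable_pi_lambda _ fun i => ?_
      by_cases hi : i = k + 1
      · subst hi; simpa using measurable_snd
      · simp only [Function.update_of_ne hi]; fun_prop
    refine ⟨R.map fun p => Function.update p.1 (k + 1) p.2,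
      Measure.isProbabilityMeasure_map hupd.aemeasurable, fun i hi => ?_, fun i hi => ?_⟩
    · rw [Measure.map_map (measurable_pi_apply i) hupd]
      rcases Nat.lt_or_ge k i with hki | hki
      · obtain rfl : i = k + 1 := by omega
        rw [← hsnd k (by omega), ← hlast, Measure.map_map measurable_snd (by fun_prop)]
        congr 1
        ext p
        simp
      · rw [← hmarg i hki]
        rw [← hR1]
        rw [Measure.map_map (measurable_pi_apply i) measurable_fst]
        congr 1
        ext p
        simp [Function.update_of_ne (show i ≠ k + 1 by omega)]
    · rw [Measure.map_map (by fun_prop) hupd]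
      rcases Nat.lt_or_ge i k with hki | hki
      · rw [← hpair i hki]
        rw [← hR1]
        rw [Measure.map_map (by fun_prop) measurable_fst]
        congr 1
        ext p <;> simp [Function.update_of_ne (show i ≠ k + 1 by omega),
          Function.update_of_ne (show i + 1 ≠ k + 1 by omega)]
      · obtain rfl : i = k := by omega
        rw [← hlast]
        congr 1
        ext p <;> simp

end Gluing

section Energy

lemma partition_sum_le_toReal {D : ℝ → ℝ → ℝ} (hD : energyOf D ≠ ⊤) {k : ℕ} {t : ℕ → ℝ}
    (ht : IsPartition k t) :
    ∑ i ∈ Finset.range k, D (t i) (t (i + 1)) / (t (i + 1) - t i) ≤ (energyOf D).toReal := by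
  rw [← ENNReal.ofReal_le_iff_le_toReal hD]
  exact le_iSup_of_le k (le_iSup_of_le t (le_iSup_of_le ht le_rfl))

lemma IsPartition.monotoneOn {k : ℕ} {t : ℕ → ℝ} (ht : IsPartition k t) {i j : ℕ} (hij : i ≤ j)
    (hj : j ≤ k) : t i ≤ t j := by
  induction j, hij using Nat.le_induction with
  | base => exact le_rfl
  | succ j _ ih => exact (ih (by omega)).trans (ht.2.2.2 j (by omega)).le

lemma IsPartition.mem_Icc {k : ℕ} {t : ℕ → ℝ} (ht : IsPartition k t) {i : ℕ} (hi : i ≤ k) :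
    t i ∈ Icc (0 : ℝ) 1 :=
  ⟨ht.2.1 ▸ ht.monotoneOn (Nat.zero_le i) hi, ht.2.2.1 ▸ ht.monotoneOn hi le_rfl⟩

/-- A smaller squared distance on `[0, 1]` has smaller energy. -/
lemma energyOf_mono {D D' : ℝ → ℝ → ℝ}
    (h : ∀ s ∈ Icc (0 : ℝ) 1, ∀ t ∈ Icc (0 : ℝ) 1, D s t ≤ D' s t) : energyOf D ≤ energyOf D' := by
  refine iSup_le fun k => iSup_le fun t => iSup_le fun ht => ?_
  refine le_trans (ENNReal.ofReal_le_ofReal (Finset.sum_le_sum fun i hi => ?_))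
    (le_iSup_of_le k (le_iSup_of_le t (le_iSup_of_le ht le_rfl)))
  have hi := Finset.mem_range.1 hi
  exact div_le_div_of_nonneg_right (h _ (ht.mem_Icc hi.le) _ (ht.mem_Icc hi))
    (sub_nonneg.2 (ht.2.2.2 i hi).le)

lemma exists_partition_of_lt {s t : ℝ} (hs : 0 ≤ s) (hst : s < t) (ht : t ≤ 1) :
    ∃ (k : ℕ) (τ : ℕ → ℝ) (j : ℕ), IsPartition k τ ∧ j < k ∧ τ j = s ∧ τ (j + 1) = t := by
  rcases hs.eq_or_lt with rfl | hs <;> rcases ht.eq_or_lt with rfl | ht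
  · refine ⟨1, fun i => i, 0, ⟨by simp, by simp, by simp, ?_⟩, by simp, by simp, by simp⟩
    intro i hi; simp
  · refine ⟨2, fun i => if i = 0 then 0 else if i = 1 then t else 1, 0,
      ⟨by simp, by simp, by simp, ?_⟩, by simp, by simp, by simp⟩
    intro i hi; interval_cases i <;> simp [*]
  · refine ⟨2, fun i => if i = 0 then 0 else if i = 1 then s else 1, 1,
      ⟨by simp, by simp, by simp, ?_⟩, by simp, by simp, by simp⟩
    intro i hi; interval_cases i <;> simp [*]
  · refine ⟨3, fun i => if i = 0 then 0 else if i = 1 then s else if i = 2 then t else 1, 1,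
      ⟨by simp, by simp, by simp, ?_⟩, by simp, by simp, by simp⟩
    intro i hi; interval_cases i <;> simp [*]

lemma le_energyOf_mul_sub {D : ℝ → ℝ → ℝ} (hD : energyOf D ≠ ⊤) (hnonneg : ∀ s t, 0 ≤ D s t)
    {s t : ℝ} (hs : 0 ≤ s) (hst : s < t) (ht : t ≤ 1) :
    D s t ≤ (energyOf D).toReal * (t - s) := by
  obtain ⟨k, τ, j, hτ, hj, rfl, rfl⟩ := exists_partition_of_lt hs hst ht
  rw [← div_le_iff₀ (sub_pos.2 hst)]
  refine le_trans ?_ (partition_sum_le_toReal hD hτ)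
  exact Finset.single_le_sum (f := fun i => D (τ i) (τ (i + 1)) / (τ (i + 1) - τ i))
    (fun i hi => div_nonneg (hnonneg _ _) (sub_nonneg.2 (hτ.2.2.2 i (Finset.mem_range.1 hi)).le))
    (Finset.mem_range.2 hj)

lemma dist_sq_le_sum_dist_sq {E : Type*} [PseudoMetricSpace E] (x : ℕ → E) {a b : ℕ} (hab : a ≤ b) :
    dist (x a) (x b) ^ 2 ≤ ((b : ℝ) - a) * ∑ i ∈ Finset.Ico a b, dist (x i) (x (i + 1)) ^ 2 := by
  calc dist (x a) (x b) ^ 2 ≤ (∑ i ∈ Finset.Ico a b, dist (x i) (x (i + 1))) ^ 2 := by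
        gcongr; exact dist_le_Ico_sum_dist x hab
    _ ≤ _ := sq_sum_le_card_mul_sum_sq
    _ = _ := by rw [Nat.card_Ico, Nat.cast_sub hab]

/-- Passing to a subsequence decreases the discrete energy. -/
lemma sum_subseq_le_sum_dist_sq {E : Type*} [PseudoMetricSpace E] (x : ℕ → E) (a : ℕ → ℕ) (k : ℕ)
    (ha : ∀ i < k, a i < a (i + 1)) :
    ∑ j ∈ Finset.range k, dist (x (a j)) (x (a (j + 1))) ^ 2 / ((a (j + 1) : ℝ) - a j) ≤
      ∑ i ∈ Finset.range (a k), dist (x i) (x (i + 1)) ^ 2 := by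
  induction k with
  | zero => simpa using Finset.sum_nonneg fun i _ => sq_nonneg _
  | succ k ih =>
    have hk := ha k (by omega)
    rw [Finset.sum_range_succ, ← Finset.sum_range_add_sum_Ico _ hk.le]
    refine add_le_add (ih fun i hi => ha i (by omega)) ?_
    rw [div_le_iff₀ (sub_pos.2 (by exact_mod_cast hk)), mul_comm]
    exact dist_sq_le_sum_dist_sq x hk.le

end Energy

/-- A continuous function on a compact metric space has modulus of continuity `ε + C d²`. -/
lemma exists_abs_sub_le_add_dist_sq {E : Type*} [PseudoMetricSpace E] [CompactSpace E]
    (g : BoundedContinuousFunction E ℝ) {ε : ℝ} (hε : 0 < ε) :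
    ∃ C : ℝ, 0 ≤ C ∧ ∀ x y, |g x - g y| ≤ ε + C * dist x y ^ 2 := by
  have huc := CompactSpace.uniformContinuous_of_continuous g.continuous
  obtain ⟨δ, hδ, h⟩ := Metric.uniformContinuous_iff.1 huc ε hε
  refine ⟨2 * ‖g‖ / δ ^ 2, by positivity, fun x y => ?_⟩
  rcases lt_or_ge (dist x y) δ with hxy | hxy
  · have := (h hxy).le
    rw [Real.dist_eq] at this
    have : 0 ≤ 2 * ‖g‖ / δ ^ 2 * dist x y ^ 2 := by positivity
    linarith
  · have h1 : |g x - g y| ≤ 2 * ‖g‖ := by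
      rw [← Real.dist_eq]; exact g.dist_le_two_norm x y
    have h2 : 2 * ‖g‖ ≤ 2 * ‖g‖ / δ ^ 2 * dist x y ^ 2 := by
      rw [div_mul_eq_mul_div, le_div_iff₀ (by positivity)]
      gcongr
    linarith

section Wasserstein

variable {K : Type*} [MetricSpace K] [MeasurableSpace K]

lemma W2sq_set_bddBelow (μ ν : Measure K) :
    BddBelow {e | ∃ m : Measure (K × K), IsProbabilityMeasure m ∧
      m.map Prod.fst = μ ∧ m.map Prod.snd = ν ∧ e = ∫ p, dist p.1 p.2 ^ 2 ∂m} := by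
  refine ⟨0, ?_⟩
  rintro e ⟨m, -, -, -, rfl⟩
  exact integral_nonneg fun p => sq_nonneg _

lemma W2sq_nonneg (μ ν : Measure K) : 0 ≤ W2sq μ ν := by
  refine Real.sInf_nonneg ?_
  rintro e ⟨m, -, -, -, rfl⟩
  exact integral_nonneg fun p => sq_nonneg _

lemma exists_coupling_lt (μ ν : Measure K) [IsProbabilityMeasure μ] [IsProbabilityMeasure ν]
    {ε : ℝ} (hε : 0 < ε) :
    ∃ m : Measure (K × K), IsProbabilityMeasure m ∧ m.map Prod.fst = μ ∧ m.map Prod.snd = ν ∧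
      ∫ p, dist p.1 p.2 ^ 2 ∂m < W2sq μ ν + ε := by
  obtain ⟨e, ⟨m, hm, h1, h2, rfl⟩, hlt⟩ := Real.lt_sInf_add_pos
    (s := {e | ∃ m : Measure (K × K), IsProbabilityMeasure m ∧
      m.map Prod.fst = μ ∧ m.map Prod.snd = ν ∧ e = ∫ p, dist p.1 p.2 ^ 2 ∂m})
    ⟨_, μ.prod ν, inferInstance, by simp, by simp, rfl⟩ hε
  exact ⟨m, hm, h1, h2, hlt⟩

variable [CompactSpace K] [BorelSpace K]

lemma W2sq_map_le {Ω : Type*} [MeasurableSpace Ω] (P : Measure Ω) [IsProbabilityMeasure P]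
    {X Y : Ω → K} (hX : Measurable X) (hY : Measurable Y) :
    W2sq (P.map X) (P.map Y) ≤ ∫ ω, dist (X ω) (Y ω) ^ 2 ∂P := by
  refine csInf_le (W2sq_set_bddBelow _ _) ⟨P.map fun ω => (X ω, Y ω),
    Measure.isProbabilityMeasure_map (by fun_prop), ?_, ?_, ?_⟩
  · rw [Measure.map_map measurable_fst (by fun_prop)]; rfl
  · rw [Measure.map_map measurable_snd (by fun_prop)]; rfl
  · rw [integral_map (by fun_prop) (by fun_prop)]

/-- Convergence in the Wasserstein distance implies weak convergence. -/
lemma abs_integral_sub_le_W2sq (g : BoundedContinuousFunction K ℝ) {ε C : ℝ}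
    (hC : 0 ≤ C) (hg : ∀ x y, |g x - g y| ≤ ε + C * dist x y ^ 2)
    (μ ν : Measure K) [IsProbabilityMeasure μ] [IsProbabilityMeasure ν] :
    |∫ x, g x ∂μ - ∫ x, g x ∂ν| ≤ ε + C * W2sq μ ν := by
  refine le_of_forall_pos_le_add fun η hη => ?_
  obtain ⟨m, hm, rfl, rfl, hlt⟩ := exists_coupling_lt μ ν (ε := η / (C + 1)) (by positivity)
  have hi (f : K × K → ℝ) (hf : Continuous f) : Integrable f m :=
    hf.integrable_of_hasCompactSupport (HasCompactSupport.of_compactSpace f)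
  rw [integral_map (by fun_prop) (by fun_prop), integral_map (by fun_prop) (by fun_prop),
    ← integral_sub (hi _ (by fun_prop)) (hi _ (by fun_prop))]
  calc |∫ p, (g p.1 - g p.2) ∂m| ≤ ∫ p, |g p.1 - g p.2| ∂m := abs_integral_le_integral_abs
    _ ≤ ∫ p, (ε + C * dist p.1 p.2 ^ 2) ∂m :=
        integral_mono (hi _ (by fun_prop)) (hi _ (by fun_prop)) fun p => hg _ _
    _ = ε + C * ∫ p, dist p.1 p.2 ^ 2 ∂m := by
        rw [integral_add (hi _ (by fun_prop)) (hi _ (by fun_prop)), integral_const_mul]; simp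
    _ ≤ ε + C * (W2sq (m.map Prod.fst) (m.map Prod.snd) + η / (C + 1)) := by gcongr
    _ ≤ _ := by
        have : C * (η / (C + 1)) ≤ η := by
          rw [← mul_div_assoc, div_le_iff₀ (by positivity)]; nlinarith
        linarith

end Wasserstein

section Rational

lemma eq_floor_mul_div {q : ℚ} (hq : 0 ≤ q) {N : ℕ} (hN : 0 < N) (hdvd : q.den ∣ N) :
    q = (⌊q * N⌋₊ : ℚ) / N := by
  obtain ⟨c, rfl⟩ := hdvd
  have hnum : (q.num.toNat : ℚ) = q.num := by
    exact_mod_cast Int.toNat_of_nonneg (Rat.num_nonneg.2 hq)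
  have h : q * ((q.den * c : ℕ) : ℚ) = ((q.num.toNat * c : ℕ) : ℚ) := by
    push_cast
    rw [← mul_assoc, Rat.mul_den_eq_num, hnum]
  rw [h, Nat.floor_natCast, ← h, mul_div_assoc, div_self (by exact_mod_cast hN.ne'), mul_one]

lemma eventually_den_dvd_factorial (q : ℚ) : ∀ᶠ n : ℕ in atTop, q.den ∣ n.factorial := by
  filter_upwards [eventually_ge_atTop q.den] with n hn
  exact Nat.dvd_factorial q.den_pos hn

variable {K : Type} [MetricSpace K] [CompactSpace K] [MeasurableSpace K] [BorelSpace K]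

lemma integrable_of_continuous_compactSpace {E : Type*} [TopologicalSpace E] [CompactSpace E]
    [MeasurableSpace E] [OpensMeasurableSpace E] (m : Measure E) [IsFiniteMeasure m] {f : E → ℝ}
    (hf : Continuous f) : Integrable f m :=
  hf.integrable_of_hasCompactSupport (HasCompactSupport.of_compactSpace f)

/-- Almost optimal transport along the uniform partition with `N` steps, with the time
parameter ranging over the rationals. -/
lemma exists_uniform_approximation (γ : ℝ → Measure K)
    (hprob : ∀ t ∈ Icc (0 : ℝ) 1, IsProbabilityMeasure (γ t))
    (hfin : energyOf (fun s t => W2sq (γ s) (γ t)) ≠ ⊤) {N : ℕ} (hN : 0 < N) {ε : ℝ} (hε : 0 < ε) :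
    ∃ P : ProbabilityMeasure (ℚ → K),
      (∀ i ≤ N, (P : Measure (ℚ → K)).map (fun x => x (i / N)) = γ (i / N)) ∧
      ∀ (k : ℕ) (a : ℕ → ℕ), (∀ i < k, a i < a (i + 1)) → a k ≤ N →
        ∑ j ∈ Finset.range k, (∫ x, dist (x (a j / N)) (x (a (j + 1) / N)) ^ 2 ∂(P : Measure (ℚ → K)))
          / ((a (j + 1) : ℝ) / N - a j / N) ≤
          (energyOf (fun s t => W2sq (γ s) (γ t))).toReal + ε := by
  have hN' : (0 : ℝ) < N := by exact_mod_cast hN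
  have hmem (i : ℕ) (hi : i ≤ N) : (i : ℝ) / N ∈ Icc (0 : ℝ) 1 :=
    ⟨by positivity, (div_le_one hN').2 (by exact_mod_cast hi)⟩
  have h0 : IsProbabilityMeasure (γ ((0 : ℕ) / N)) := hprob _ (hmem 0 (by omega))
  have : Nonempty K := nonempty_of_isProbabilityMeasure (γ ((0 : ℕ) / N))
  have hc : ∀ i : ℕ, ∃ m : Measure (K × K), i < N → IsProbabilityMeasure m ∧
      m.map Prod.fst = γ (i / N) ∧ m.map Prod.snd = γ ((i + 1 : ℕ) / N) ∧
      ∫ p, dist p.1 p.2 ^ 2 ∂m < W2sq (γ (i / N)) (γ ((i + 1 : ℕ) / N)) + ε / N ^ 2 := by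
    intro i
    by_cases hi : i < N
    · have := hprob _ (hmem i hi.le)
      have := hprob _ (hmem (i + 1) hi)
      obtain ⟨m, hm⟩ := exists_coupling_lt (γ (i / N)) (γ ((i + 1 : ℕ) / N))
        (ε := ε / N ^ 2) (by positivity)
      exact ⟨m, fun _ => hm⟩
    · exact ⟨0, fun h => absurd h hi⟩
  choose m hm using hc
  obtain ⟨Q, hQ, hmarg, hpair⟩ := exists_glued_measure (fun i : ℕ => γ (i / N)) m N
    (fun i hi => (hm i hi).1) (fun i hi => (hm i hi).2.1) (fun i hi => (hm i hi).2.2.1)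
  let F : (ℕ → K) → (ℚ → K) := fun x q => x ⌊q * N⌋₊
  have hF : Measurable F := by fun_prop
  have hFi (x : ℕ → K) (i : ℕ) : F x (i / N) = x i := by
    have : (N : ℚ) ≠ 0 := by exact_mod_cast hN.ne'
    simp [F, div_mul_cancel₀ _ this]
  refine ⟨⟨Q.map F, Measure.isProbabilityMeasure_map hF.aemeasurable⟩, fun i hi => ?_,
    fun k a ha hak => ?_⟩
  · rw [← hmarg i hi, ProbabilityMeasure.coe_mk, Measure.map_map (by fun_prop) hF]
    congr 1
    ext x
    exact hFi x i
  have hint (i j : ℕ) : Integrable (fun x : ℕ → K => dist (x i) (x j) ^ 2) Q :=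
    integrable_of_continuous_compactSpace Q (by fun_prop)
  have hstep (i : ℕ) (hi : i < N) : ∫ x, dist (x i) (x (i + 1)) ^ 2 ∂Q ≤
      W2sq (γ (i / N)) (γ ((i + 1 : ℕ) / N)) + ε / N ^ 2 := by
    refine le_trans (le_of_eq ?_) (hm i hi).2.2.2.le
    rw [← hpair i hi, integral_map (by fun_prop) (by fun_prop)]
  have hpart : IsPartition N (fun i => (i : ℝ) / N) := by
    refine ⟨hN, by simp, div_self hN'.ne', fun i _ => ?_⟩
    simp only [Nat.cast_add, Nat.cast_one]
    gcongr
    linarith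
  have hE := partition_sum_le_toReal hfin hpart
  calc _ = N * ∑ j ∈ Finset.range k,
        (∫ x, dist (x (a j)) (x (a (j + 1))) ^ 2 ∂Q) / ((a (j + 1) : ℝ) - a j) := by
        rw [Finset.mul_sum]
        refine Finset.sum_congr rfl fun j hj => ?_
        rw [ProbabilityMeasure.coe_mk, integral_map hF.aemeasurable
          (Continuous.aestronglyMeasurable (by fun_prop))]
        simp only [hFi]
        rw [← sub_div, div_div_eq_mul_div]
        ring
    _ = N * ∫ x, ∑ j ∈ Finset.range k,
        dist (x (a j)) (x (a (j + 1))) ^ 2 / ((a (j + 1) : ℝ) - a j) ∂Q := by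
        rw [integral_finsetSum _ fun j _ => (hint _ _).div_const _]
        simp only [integral_div]
    _ ≤ N * ∫ x, ∑ i ∈ Finset.range N, dist (x i) (x (i + 1)) ^ 2 ∂Q := by
        gcongr ?_ * ?_
        refine integral_mono (integrable_finsetSum _ fun j _ => (hint _ _).div_const _)
          (integrable_finsetSum _ fun j _ => hint _ _) fun x => ?_
        refine (sum_subseq_le_sum_dist_sq x a k ha).trans ?_
        exact Finset.sum_le_sum_of_subset_of_nonneg (Finset.range_mono hak)
          fun i _ _ => sq_nonneg _
    _ = N * ∑ i ∈ Finset.range N, ∫ x, dist (x i) (x (i + 1)) ^ 2 ∂Q := by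
        rw [integral_finsetSum _ fun j _ => hint _ _]
    _ ≤ N * ∑ i ∈ Finset.range N, (W2sq (γ (i / N)) (γ ((i + 1 : ℕ) / N)) + ε / N ^ 2) := by
        gcongr with i hi
        exact hstep i (Finset.mem_range.1 hi)
    _ = ∑ i ∈ Finset.range N, W2sq (γ (i / N)) (γ ((i + 1 : ℕ) / N))
          / (((i + 1 : ℕ) : ℝ) / N - i / N) + ε := by
        rw [Finset.sum_add_distrib, mul_add, Finset.mul_sum]
        congr 1
        · refine Finset.sum_congr rfl fun i _ => ?_
          rw [← sub_div]
          push_cast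
          field_simp
          ring
        · simp
          field_simp
    _ ≤ _ := by gcongr

/-- The law of the process restricted to rational times. -/
lemma exists_rational_process (γ : ℝ → Measure K)
    (hprob : ∀ t ∈ Icc (0 : ℝ) 1, IsProbabilityMeasure (γ t))
    (hfin : energyOf (fun s t => W2sq (γ s) (γ t)) ≠ ⊤) :
    ∃ P : Measure (ℚ → K), IsProbabilityMeasure P ∧
      (∀ q : ℚ, 0 ≤ q → q ≤ 1 → P.map (fun x => x q) = γ q) ∧
      ∀ (k : ℕ) (q : ℕ → ℚ), (∀ i ≤ k, 0 ≤ q i) → q k ≤ 1 → (∀ i < k, q i < q (i + 1)) →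
        ∑ j ∈ Finset.range k, (∫ x, dist (x (q j)) (x (q (j + 1))) ^ 2 ∂P)
          / ((q (j + 1) : ℝ) - q j) ≤ (energyOf (fun s t => W2sq (γ s) (γ t))).toReal := by
  choose P hP hPE using fun n : ℕ => exists_uniform_approximation γ hprob hfin
    n.factorial_pos (ε := 1 / ((n : ℝ) + 1)) (by positivity)
  let U : Ultrafilter ℕ := hyperfilter ℕ
  have hU : (U : Filter ℕ) ≤ atTop := Nat.hyperfilter_le_atTop
  obtain ⟨P', -, hlim⟩ := isCompact_univ.ultrafilter_le_nhds (U.map P) (by simp)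
  have hlim : Tendsto P U (𝓝 P') := hlim
  have hconv (f : (ℚ → K) → ℝ) (hf : Continuous f) :
      Tendsto (fun n => ∫ x, f x ∂(P n : Measure (ℚ → K))) U (𝓝 (∫ x, f x ∂(P' : Measure (ℚ → K)))) :=
    ProbabilityMeasure.tendsto_iff_forall_integral_tendsto.1 hlim
      (BoundedContinuousFunction.mkOfCompact ⟨f, hf⟩)
  refine ⟨P', inferInstance, fun q hq hq1 => ?_, fun k q hq hqk hlt => ?_⟩
  · have hγ := hprob q ⟨by exact_mod_cast hq, by exact_mod_cast hq1⟩
    have : IsProbabilityMeasure ((P' : Measure (ℚ → K)).map fun x => x q) :=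
      Measure.isProbabilityMeasure_map (measurable_pi_apply q).aemeasurable
    refine ext_of_forall_integral_eq_of_IsFiniteMeasure fun g => ?_
    rw [integral_map (measurable_pi_apply q).aemeasurable (by fun_prop)]
    refine tendsto_nhds_unique (hconv (fun x => g (x q)) (by fun_prop)) ?_
    refine tendsto_const_nhds.congr' ?_
    filter_upwards [hU (eventually_den_dvd_factorial q)] with n hn
    have heq := eq_floor_mul_div hq n.factorial_pos hn
    have hle : ⌊q * n.factorial⌋₊ ≤ n.factorial :=
      Nat.floor_le_of_le (mul_le_of_le_one_left (by positivity) hq1)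
    have heqR : (q : ℝ) = (⌊q * n.factorial⌋₊ : ℝ) / n.factorial :=
      (congrArg Rat.cast heq).trans (by push_cast; rfl)
    have := hP n _ hle
    rw [← heq, ← heqR] at this
    rw [← this, integral_map (measurable_pi_apply q).aemeasurable (by fun_prop)]
  · have hconvE : Tendsto (fun n => ∑ j ∈ Finset.range k,
        (∫ x, dist (x (q j)) (x (q (j + 1))) ^ 2 ∂(P n : Measure (ℚ → K)))
          / ((q (j + 1) : ℝ) - q j)) U (𝓝 (∑ j ∈ Finset.range k,
        (∫ x, dist (x (q j)) (x (q (j + 1))) ^ 2 ∂(P' : Measure (ℚ → K)))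
          / ((q (j + 1) : ℝ) - q j))) :=
      tendsto_finsetSum _ fun j _ => (hconv _ (by fun_prop)).div_const _
    have hbound : Tendsto (fun n : ℕ => (energyOf (fun s t => W2sq (γ s) (γ t))).toReal +
        1 / ((n : ℝ) + 1)) U (𝓝 ((energyOf (fun s t => W2sq (γ s) (γ t))).toReal + 0)) :=
      (tendsto_const_nhds.add tendsto_one_div_add_atTop_nhds_zero_nat).mono_left hU
    rw [add_zero] at hbound
    refine le_of_tendsto_of_tendsto hconvE hbound ?_
    have hden : ∀ᶠ n : ℕ in atTop, ∀ i ∈ Finset.range (k + 1), (q i).den ∣ n.factorial :=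
      (Filter.eventually_all_finset _).2 fun i _ => eventually_den_dvd_factorial (q i)
    filter_upwards [hU hden] with n hn
    have heq (i : ℕ) (hi : i ≤ k) : q i = (⌊q i * n.factorial⌋₊ : ℚ) / n.factorial :=
      eq_floor_mul_div (hq i hi) n.factorial_pos (hn i (Finset.mem_range.2 (by omega)))
    have hfac : (0 : ℚ) < n.factorial := by exact_mod_cast n.factorial_pos
    refine le_trans (le_of_eq ?_) (hPE n k (fun i => ⌊q i * n.factorial⌋₊) ?_ ?_)
    · refine Finset.sum_congr rfl fun j hj => ?_
      have hj := Finset.mem_range.1 hj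
      have hR (i : ℕ) (hi : i ≤ k) :
          (q i : ℝ) = (⌊q i * n.factorial⌋₊ : ℝ) / n.factorial :=
        (congrArg Rat.cast (heq i hi)).trans (by push_cast; rfl)
      rw [← heq j hj.le, ← heq (j + 1) hj, ← hR j hj.le, ← hR (j + 1) hj]
    · intro i hi
      have h := hlt i hi
      rw [heq i hi.le, heq (i + 1) hi, div_lt_div_iff_of_pos_right hfac] at h
      exact_mod_cast h
    · exact Nat.floor_le_of_le (mul_le_of_le_one_left hfac.le hqk)

end Rational

section Continuity

/-- The largest multiple of `1 / n!` below `t`. -/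
noncomputable def rationalFloor (n : ℕ) (t : ℝ) : ℚ := (⌊t * n.factorial⌋₊ : ℚ) / n.factorial

lemma cast_rationalFloor (n : ℕ) (t : ℝ) :
    (rationalFloor n t : ℝ) = (⌊t * n.factorial⌋₊ : ℝ) / n.factorial := by
  rw [rationalFloor]; push_cast; rfl

lemma rationalFloor_nonneg (n : ℕ) (t : ℝ) : 0 ≤ rationalFloor n t := by
  rw [rationalFloor]; positivity

lemma cast_rationalFloor_le (n : ℕ) {t : ℝ} (ht : 0 ≤ t) : (rationalFloor n t : ℝ) ≤ t := by
  have hn : (0 : ℝ) < n.factorial := by exact_mod_cast n.factorial_pos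
  rw [cast_rationalFloor, div_le_iff₀ hn]
  exact Nat.floor_le (by positivity)

lemma rationalFloor_le_one (n : ℕ) {t : ℝ} (ht : t ∈ Icc (0 : ℝ) 1) : rationalFloor n t ≤ 1 := by
  exact_mod_cast (cast_rationalFloor_le n ht.1).trans ht.2

lemma tendsto_rationalFloor {t : ℝ} (ht : 0 ≤ t) :
    Tendsto (fun n => (rationalFloor n t : ℝ)) atTop (𝓝 t) := by
  have hfac : Tendsto (fun n : ℕ => (n.factorial : ℝ)) atTop atTop :=
    tendsto_natCast_atTop_atTop.comp factorial_tendsto_atTop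
  simp only [cast_rationalFloor]
  exact (tendsto_nat_floor_mul_div_atTop ht).comp hfac

/-- Hölder continuity of order `1/2` at rational times. -/
def IsHolderAtRationals {E : Type*} [PseudoMetricSpace E] (x : ℚ → E) : Prop :=
  ∃ C : ℕ, ∀ p q : ℚ, 0 ≤ p → p ≤ 1 → 0 ≤ q → q ≤ 1 →
    dist (x p) (x q) ^ 2 ≤ C * |(p : ℝ) - q|

lemma isHolderAtRationals_const {E : Type*} [PseudoMetricSpace E] (c : E) :
    IsHolderAtRationals fun _ : ℚ => c :=
  ⟨0, fun p q _ _ _ _ => by simp⟩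

lemma IsHolderAtRationals.exists_tendsto {E : Type*} [PseudoMetricSpace E] [CompleteSpace E]
    {x : ℚ → E} (hx : IsHolderAtRationals x) {t : ℝ} (ht : t ∈ Icc (0 : ℝ) 1) :
    ∃ y, Tendsto (fun n => x (rationalFloor n t)) atTop (𝓝 y) := by
  obtain ⟨C, hC⟩ := hx
  refine cauchySeq_tendsto_of_complete (cauchySeq_iff_tendsto_dist_atTop_0.2 ?_)
  have h := cauchySeq_iff_tendsto_dist_atTop_0.1 (tendsto_rationalFloor ht.1).cauchySeq
  have h2 := (h.const_mul (C : ℝ)).sqrt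
  rw [mul_zero, Real.sqrt_zero] at h2
  refine squeeze_zero (fun _ => dist_nonneg) (fun n => Real.le_sqrt_of_sq_le ?_) h2
  exact hC _ _ (rationalFloor_nonneg _ _) (rationalFloor_le_one _ ht) (rationalFloor_nonneg _ _)
    (rationalFloor_le_one _ ht)

lemma IsHolderAtRationals.continuousOn {E : Type*} [PseudoMetricSpace E] {x : ℚ → E}
    (hx : IsHolderAtRationals x) {f : ℝ → E}
    (hf : ∀ t ∈ Icc (0 : ℝ) 1, Tendsto (fun n => x (rationalFloor n t)) atTop (𝓝 (f t))) :
    ContinuousOn f (Icc 0 1) := by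
  obtain ⟨C, hC⟩ := hx
  have hdist (s : ℝ) (hs : s ∈ Icc (0 : ℝ) 1) (t : ℝ) (ht : t ∈ Icc (0 : ℝ) 1) :
      dist (f s) (f t) ^ 2 ≤ C * |s - t| :=
    le_of_tendsto_of_tendsto' (((hf s hs).dist (hf t ht)).pow 2)
      (((tendsto_rationalFloor hs.1).sub (tendsto_rationalFloor ht.1)).abs.const_mul (C : ℝ))
      fun n => hC _ _ (rationalFloor_nonneg _ _) (rationalFloor_le_one _ hs)
        (rationalFloor_nonneg _ _) (rationalFloor_le_one _ ht)
  intro t ht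
  refine tendsto_iff_dist_tendsto_zero.2 ?_
  have hlim : Tendsto (fun s => √(C * |s - t|)) (𝓝[Icc 0 1] t) (𝓝 0) := by
    have : Continuous fun s => √(C * |s - t|) := by fun_prop
    simpa using (this.tendsto t).mono_left nhdsWithin_le_nhds
  refine squeeze_zero' (.of_forall fun _ => dist_nonneg) ?_ hlim
  filter_upwards [self_mem_nhdsWithin] with s hs
  exact Real.le_sqrt_of_sq_le (hdist s hs t ht)

variable {K : Type} [MetricSpace K] [CompactSpace K] [MeasurableSpace K] [BorelSpace K]

lemma measurableSet_isHolderAtRationals : MeasurableSet {x : ℚ → K | IsHolderAtRationals x} := by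
  simp only [IsHolderAtRationals, ofPred_exists, ofPred_forall]
  refine .iUnion fun C => .iInter fun p => .iInter fun q => .iInter fun _ => .iInter fun _ =>
    .iInter fun _ => .iInter fun _ => ?_
  exact (isClosed_le (by fun_prop) (by fun_prop)).measurableSet

/-- A process on the rationals of finite energy is almost surely Hölder continuous. -/
lemma ae_isHolderAtRationals (P : Measure (ℚ → K)) [IsProbabilityMeasure P] (E : ℝ)
    (hE : ∀ (k : ℕ) (q : ℕ → ℚ), (∀ i ≤ k, 0 ≤ q i) → q k ≤ 1 → (∀ i < k, q i < q (i + 1)) →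
      ∑ j ∈ Finset.range k, (∫ x, dist (x (q j)) (x (q (j + 1))) ^ 2 ∂P)
        / ((q (j + 1) : ℝ) - q j) ≤ E) :
    ∀ᵐ x ∂P, IsHolderAtRationals x := by
  let S : ℕ → (ℚ → K) → ℝ := fun n x => n.factorial * ∑ i ∈ Finset.range n.factorial,
    dist (x (i / n.factorial)) (x ((i + 1 : ℕ) / n.factorial)) ^ 2
  have hS0 (n : ℕ) (x : ℚ → K) : 0 ≤ S n x := by positivity
  have hScont (n : ℕ) : Continuous (S n) := by fun_prop
  have hSE (n : ℕ) : ∫ x, S n x ∂P ≤ E := by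
    have hfac : (0 : ℚ) < n.factorial := by exact_mod_cast n.factorial_pos
    refine le_trans (le_of_eq ?_) (hE n.factorial (fun i => (i : ℚ) / n.factorial)
      (fun i _ => by positivity) (div_self hfac.ne').le fun i _ => ?_)
    · simp only [S]
      rw [integral_const_mul, integral_finsetSum _ fun i _ =>
        integrable_of_continuous_compactSpace P (by fun_prop), Finset.mul_sum]
      refine Finset.sum_congr rfl fun i _ => ?_
      push_cast
      rw [← sub_div, div_div_eq_mul_div]
      ring
    · rw [div_lt_div_iff_of_pos_right hfac]
      exact_mod_cast Nat.lt_succ_self i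
  have hfatou : ∫⁻ x, liminf (fun n => ENNReal.ofReal (S n x)) atTop ∂P ≠ ⊤ := by
    refine ne_top_of_le_ne_top (ENNReal.ofReal_ne_top (r := E)) ?_
    refine (lintegral_liminf_le fun n => (hScont n).measurable.ennreal_ofReal).trans ?_
    refine (liminf_le_liminf (.of_forall fun n => ?_)).trans (liminf_const _).le
    rw [← ofReal_integral_eq_lintegral_ofReal (integrable_of_continuous_compactSpace P (hScont n))
      (.of_forall (hS0 n))]
    exact ENNReal.ofReal_le_ofReal (hSE n)
  filter_upwards [ae_lt_top (.liminf fun n => (hScont n).measurable.ennreal_ofReal) hfatou]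
    with x hx
  obtain ⟨C, hC⟩ := ENNReal.exists_nat_gt hx.ne
  have hfreq : ∃ᶠ n in atTop, ENNReal.ofReal (S n x) < C :=
    frequently_lt_of_liminf_lt (by isBoundedDefault) hC
  have key (p q : ℚ) (hp : 0 ≤ p) (hpq : p ≤ q) (hq : q ≤ 1) :
      dist (x p) (x q) ^ 2 ≤ C * ((q : ℝ) - p) := by
    obtain ⟨n, hn, hpn, hqn⟩ := (hfreq.and_eventually
      ((eventually_den_dvd_factorial p).and (eventually_den_dvd_factorial q))).exists
    have hfac : (0 : ℚ) < n.factorial := by exact_mod_cast n.factorial_pos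
    have hfac' : (0 : ℝ) < n.factorial := by exact_mod_cast n.factorial_pos
    have hSC : S n x ≤ C := by
      have := (ENNReal.ofReal_lt_iff_lt_toReal (hS0 n x) (ENNReal.natCast_ne_top C)).1 hn
      simpa using this.le
    obtain ⟨a, rfl⟩ : ∃ a : ℕ, p = a / n.factorial := ⟨_, eq_floor_mul_div hp n.factorial_pos hpn⟩
    obtain ⟨b, rfl⟩ : ∃ b : ℕ, q = b / n.factorial :=
      ⟨_, eq_floor_mul_div (hp.trans hpq) n.factorial_pos hqn⟩
    have hab : a ≤ b := by
      rw [div_le_div_iff_of_pos_right hfac] at hpq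
      exact_mod_cast hpq
    have hbn : b ≤ n.factorial := by
      rw [div_le_one hfac] at hq
      exact_mod_cast hq
    have hab' : (0 : ℝ) ≤ (b : ℝ) - a := sub_nonneg.2 (by exact_mod_cast hab)
    calc _ ≤ ((b : ℝ) - a) * ∑ i ∈ Finset.Ico a b,
          dist (x (i / n.factorial)) (x ((i + 1 : ℕ) / n.factorial)) ^ 2 :=
          dist_sq_le_sum_dist_sq (fun i : ℕ => x (i / n.factorial)) hab
      _ ≤ ((b : ℝ) - a) * ∑ i ∈ Finset.range n.factorial,
          dist (x (i / n.factorial)) (x ((i + 1 : ℕ) / n.factorial)) ^ 2 := by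
          gcongr
          intro i hi
          simp only [Finset.mem_Ico, Finset.mem_range] at hi ⊢
          omega
      _ = S n x * (((b : ℝ) - a) / n.factorial) := by
          simp only [S]
          field_simp
      _ ≤ C * (((b : ℝ) - a) / n.factorial) := by gcongr
      _ = _ := by push_cast; rw [sub_div]
  refine ⟨C, fun p q hp hp1 hq hq1 => ?_⟩
  rcases le_total p q with h | h
  · rw [abs_sub_comm, abs_of_nonneg (sub_nonneg.2 (by exact_mod_cast h))]
    exact key p q hp h hq1
  · rw [dist_comm, abs_of_nonneg (sub_nonneg.2 (by exact_mod_cast h))]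
    exact key q p hq h hp1

/-- Finite energy paths are weakly continuous. -/
lemma tendsto_integral_rationalFloor (γ : ℝ → Measure K)
    (hprob : ∀ t ∈ Icc (0 : ℝ) 1, IsProbabilityMeasure (γ t))
    (hfin : energyOf (fun s t => W2sq (γ s) (γ t)) ≠ ⊤) (g : BoundedContinuousFunction K ℝ)
    {t : ℝ} (ht : t ∈ Icc (0 : ℝ) 1) :
    Tendsto (fun n => ∫ x, g x ∂(γ (rationalFloor n t))) atTop (𝓝 (∫ x, g x ∂(γ t))) := by
  refine Metric.tendsto_nhds.2 fun ε hε => ?_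
  obtain ⟨C, hC, hg⟩ := exists_abs_sub_le_add_dist_sq g (half_pos hε)
  set E := (energyOf (fun s t => W2sq (γ s) (γ t))).toReal
  have hlim : Tendsto (fun n => ε / 2 + C * (E * (t - rationalFloor n t))) atTop (𝓝 (ε / 2)) := by
    simpa using ((((tendsto_rationalFloor ht.1).const_sub t).const_mul E).const_mul C).const_add
      (ε / 2)
  filter_upwards [hlim.eventually_lt_const (half_lt_self hε)] with n hn
  have h0 : (0 : ℝ) ≤ rationalFloor n t := by exact_mod_cast rationalFloor_nonneg n t
  have hle := cast_rationalFloor_le n ht.1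
  rcases hle.eq_or_lt with heq | hlt
  · rw [heq, dist_self]; exact hε
  have := hprob t ht
  have := hprob _ ⟨h0, hle.trans ht.2⟩
  rw [Real.dist_eq]
  refine (abs_integral_sub_le_W2sq g hC hg _ _).trans_lt (lt_of_le_of_lt ?_ hn)
  gcongr
  exact le_energyOf_mul_sub hfin (fun s t => W2sq_nonneg _ _) h0 hlt ht.2

end Continuity

/-- a finite-energy path of Borel probability measures on a compact metric
space (in the 2-Wasserstein metric) can be realized, in an energy-preserving way, as a
stochastic process with continuous sample paths. -/
theorem realization_of_measure_valued_paths
    {K : Type} [MetricSpace K] [CompactSpace K] [MeasurableSpace K] [BorelSpace K]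
    (γ : ℝ → Measure K)
    (hprob : ∀ t ∈ Icc (0:ℝ) 1, IsProbabilityMeasure (γ t))
    (hfin : energyOf (fun s t => W2sq (γ s) (γ t)) ≠ ⊤) :
    ∃ (Ω : Type) (_ : MeasurableSpace Ω) (P : Measure Ω) (X : ℝ → Ω → K),
      IsProbabilityMeasure P ∧
      (∀ ω, ContinuousOn (fun t => X t ω) (Icc 0 1)) ∧
      (∀ t ∈ Icc (0:ℝ) 1, Measurable (X t)) ∧
      (∀ t ∈ Icc (0:ℝ) 1, P.map (X t) = γ t) ∧
      energyOf (fun s t => ∫ ω, dist (X s ω) (X t ω) ^ 2 ∂P) =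
        energyOf (fun s t => W2sq (γ s) (γ t)) := by
  obtain ⟨P, hP, hmarg, hE⟩ := exists_rational_process γ hprob hfin
  have := hprob 0 (by simp)
  have hne : Nonempty K := nonempty_of_isProbabilityMeasure (γ 0)
  obtain ⟨c⟩ := id hne
  classical
  let Z : (ℚ → K) → ℚ → K := fun x => if IsHolderAtRationals x then x else fun _ => c
  have hZ (x : ℚ → K) : IsHolderAtRationals (Z x) := by
    by_cases h : IsHolderAtRationals x
    · simp [Z, h]
    · simpa [Z, h] using isHolderAtRationals_const c
  have hZmeas : Measurable Z :=
    Measurable.ite measurableSet_isHolderAtRationals measurable_id measurable_const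
  have hZae : ∀ᵐ x ∂P, Z x = x := by
    filter_upwards [ae_isHolderAtRationals P _ hE] with x hx
    simp [Z, hx]
  choose! X hX using fun (t : ℝ) (x : ℚ → K) (ht : t ∈ Icc (0 : ℝ) 1) => (hZ x).exists_tendsto ht
  have hXmeas (t : ℝ) (ht : t ∈ Icc (0 : ℝ) 1) : Measurable (X t) :=
    measurable_of_tendsto_metrizable (fun n => (measurable_pi_apply _).comp hZmeas)
      (tendsto_pi_nhds.2 fun x => hX t x ht)
  have hlaw (t : ℝ) (ht : t ∈ Icc (0 : ℝ) 1) : P.map (X t) = γ t := by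
    have := hprob t ht
    have : IsProbabilityMeasure (P.map (X t)) :=
      Measure.isProbabilityMeasure_map (hXmeas t ht).aemeasurable
    refine ext_of_forall_integral_eq_of_IsFiniteMeasure fun g => ?_
    rw [integral_map (hXmeas t ht).aemeasurable (by fun_prop)]
    refine tendsto_nhds_unique ?_ (tendsto_integral_rationalFloor γ hprob hfin g ht)
    have hlim : Tendsto (fun n => ∫ x, g (Z x (rationalFloor n t)) ∂P) atTop
        (𝓝 (∫ x, g (X t x) ∂P)) := by
      refine tendsto_integral_of_dominated_convergence (fun _ => ‖g‖) (fun n => ?_)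
        (integrable_const _) (fun n => .of_forall fun x => g.norm_coe_le_norm _)
        (.of_forall fun x => (g.continuous.tendsto _).comp (hX t x ht))
      exact (g.continuous.measurable.comp
        ((measurable_pi_apply _).comp hZmeas)).aestronglyMeasurable
    refine hlim.congr fun n => ?_
    rw [← hmarg _ (rationalFloor_nonneg n t) (rationalFloor_le_one n ht),
      integral_map (measurable_pi_apply _).aemeasurable (by fun_prop)]
    exact integral_congr_ae (hZae.mono fun x hx => by simp only [hx])
  refine ⟨ℚ → K, inferInstance, P, X, hP, fun x => (hZ x).continuousOn fun t ht => hX t x ht,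
    hXmeas, hlaw, le_antisymm ?_ ?_⟩
  · refine iSup_le fun k => iSup_le fun t => iSup_le fun ht => ?_
    rw [ENNReal.ofReal_le_iff_le_toReal hfin]
    have hpair (s : ℝ) (hs : s ∈ Icc (0 : ℝ) 1) (t : ℝ) (ht : t ∈ Icc (0 : ℝ) 1) :
        Tendsto (fun n => ∫ x, dist (x (rationalFloor n s)) (x (rationalFloor n t)) ^ 2 ∂P) atTop
          (𝓝 (∫ x, dist (X s x) (X t x) ^ 2 ∂P)) := by
      have hlim : Tendsto (fun n => ∫ x, dist (Z x (rationalFloor n s)) (Z x (rationalFloor n t)) ^ 2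
          ∂P) atTop (𝓝 (∫ x, dist (X s x) (X t x) ^ 2 ∂P)) := by
        refine tendsto_integral_of_dominated_convergence (fun _ => Metric.diam (univ : Set K) ^ 2)
          (fun n => ?_) (integrable_const _) (fun n => .of_forall fun x => ?_)
          (.of_forall fun x => ((hX s x hs).dist (hX t x ht)).pow 2)
        · exact ((((measurable_pi_apply _).comp hZmeas).dist
            ((measurable_pi_apply _).comp hZmeas)).pow_const 2).aestronglyMeasurable
        · rw [Real.norm_of_nonneg (by positivity)]
          gcongr
          exact Metric.dist_le_diam_of_mem isCompact_univ.isBounded (mem_univ _) (mem_univ _)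
      exact hlim.congr fun n => integral_congr_ae (hZae.mono fun x hx => by simp only [hx])
    have hmem (i : ℕ) (hi : i ≤ k) : t i ∈ Icc (0 : ℝ) 1 := ht.mem_Icc hi
    have hsum : Tendsto (fun n => ∑ i ∈ Finset.range k,
        (∫ x, dist (x (rationalFloor n (t i))) (x (rationalFloor n (t (i + 1)))) ^ 2 ∂P) /
          ((rationalFloor n (t (i + 1)) : ℝ) - rationalFloor n (t i))) atTop
        (𝓝 (∑ i ∈ Finset.range k, (∫ x, dist (X (t i) x) (X (t (i + 1)) x) ^ 2 ∂P) /
          (t (i + 1) - t i))) := by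
      refine tendsto_finsetSum _ fun i hi => ?_
      have hi := Finset.mem_range.1 hi
      exact (hpair _ (hmem i hi.le) _ (hmem (i + 1) hi)).div
        ((tendsto_rationalFloor (hmem (i + 1) hi).1).sub (tendsto_rationalFloor (hmem i hi.le).1))
        (sub_pos.2 (ht.2.2.2 i hi)).ne'
    refine le_of_tendsto hsum ?_
    have hlt : ∀ᶠ n in atTop, ∀ i ∈ Finset.range k,
        (rationalFloor n (t i) : ℝ) < rationalFloor n (t (i + 1)) := by
      refine (Filter.eventually_all_finset _).2 fun i hi => ?_
      have hi := Finset.mem_range.1 hi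
      exact (tendsto_rationalFloor (hmem i hi.le).1).eventually_lt
        (tendsto_rationalFloor (hmem (i + 1) hi).1) (ht.2.2.2 i hi)
    filter_upwards [hlt] with n hn
    refine hE k (fun i => rationalFloor n (t i)) (fun i _ => rationalFloor_nonneg _ _)
      (rationalFloor_le_one n (hmem k le_rfl)) fun i hi => ?_
    exact_mod_cast hn i (Finset.mem_range.2 hi)
  · refine energyOf_mono fun s hs t ht => ?_
    rw [← hlaw s hs, ← hlaw t ht]
    exact W2sq_map_le P (hXmeas s hs) (hXmeas t ht)
end
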